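/- arXiv:1305.0509 — 3 statements merged into one kernel-verified Lean document; each statement's English description precedes it below -/
import Mathlib

section
/- Let a, b > 0 and α ∈ (0,1). Then there exists a constant c > 0 (depending only on a, b, α) such that for every Schwartz function f : ℝ² → ℂ, ‖J^{αa}(⟨x,y⟩^{(1−α)b} f)‖_{L²(ℝ²)} ≤ c · ‖⟨x,y⟩^{b} f‖_{L²(ℝ²)}^{1−α} · ‖J^{a} f‖_{L²(ℝ²)}^{α}. -/
open MeasureTheory

/-- The Fourier transform on `ℝ²`: `f̂(ξ,η) = ∫ e^{−i(xξ+yη)} f(x,y) dx dy`. -/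
noncomputable def FT2 (f : ℝ × ℝ → ℂ) (q : ℝ × ℝ) : ℂ :=
  ∫ p : ℝ × ℝ, Complex.exp (-(Complex.I * ((p.1 : ℂ) * (q.1 : ℂ) + (p.2 : ℂ) * (q.2 : ℂ)))) * f p

/-- The Bessel potential operator `J^s` on `ℝ²`, defined via the Fourier transform by
`(J^s g)^(ξ,η) = (1 + ξ² + η²)^{s/2} ĝ(ξ,η)`; here realized by Fourier inversion. -/
noncomputable def Jop (s : ℝ) (f : ℝ × ℝ → ℂ) (p : ℝ × ℝ) : ℂ :=
  ((1 / (2 * Real.pi) ^ 2 : ℝ) : ℂ) *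
    ∫ q : ℝ × ℝ, Complex.exp (Complex.I * ((p.1 : ℂ) * (q.1 : ℂ) + (p.2 : ℂ) * (q.2 : ℂ))) *
      (((1 + q.1 ^ 2 + q.2 ^ 2) ^ (s / 2) : ℝ) : ℂ) * FT2 f q

/-- The `L²(ℝ²)` norm. -/
noncomputable def L2norm2 (f : ℝ × ℝ → ℂ) : ℝ :=
  (∫ p : ℝ × ℝ, ‖f p‖ ^ 2) ^ ((1 : ℝ) / 2)

/-- The Japanese bracket power `⟨x,y⟩^c = (1 + x² + y²)^{c/2}` on `ℝ²`. -/
noncomputable def jbr (c : ℝ) (p : ℝ × ℝ) : ℝ :=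
  (1 + p.1 ^ 2 + p.2 ^ 2) ^ (c / 2)


section Main
set_option linter.unusedSectionVars false
open SchwartzMap FourierTransform
open scoped ENNReal NNReal

variable {V : Type*} [NormedAddCommGroup V] [InnerProductSpace ℝ V]

/-- The weight `1 + ‖x‖²`. -/
noncomputable def wW (x : V) : ℝ := 1 + ‖x‖ ^ 2

lemma one_le_wW (x : V) : 1 ≤ wW x := by unfold wW; nlinarith [sq_nonneg ‖x‖]
lemma wW_pos (x : V) : 0 < wW x := lt_of_lt_of_le one_pos (one_le_wW x)
lemma continuous_wW : Continuous (wW : V → ℝ) := by unfold wW; fun_prop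

lemma wW_neg (x : V) : wW (-x) = wW x := by simp [wW]

lemma wW_peetre (x y : V) : wW x ≤ 2 * (wW y * wW (x - y)) := by
  unfold wW
  have h : ‖x‖ ≤ ‖y‖ + ‖x - y‖ := by
    simpa using norm_add_le y (x - y)
  have h2 : ‖x‖ ^ 2 ≤ (‖y‖ + ‖x - y‖) ^ 2 := by gcongr
  nlinarith [sq_nonneg (‖y‖ - ‖x - y‖), sq_nonneg (‖y‖ * ‖x - y‖)]

lemma wW_rpow_peetre {s : ℝ} (hs : 0 ≤ s) (x y : V) :
    wW x ^ s ≤ 2 ^ s * (wW y ^ s * wW (x - y) ^ s) := by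
  rw [← Real.mul_rpow (wW_pos y).le (wW_pos _).le,
    ← Real.mul_rpow (by norm_num) (mul_nonneg (wW_pos y).le (wW_pos _).le)]
  exact Real.rpow_le_rpow (wW_pos x).le (wW_peetre x y) hs

/-- The weight as an extended nonnegative real. -/
noncomputable def eW (s : ℝ) (x : V) : ℝ≥0∞ := ENNReal.ofReal (wW x ^ s)

lemma continuous_wW_rpow (s : ℝ) : Continuous (fun x : V => wW x ^ s) :=
  continuous_wW.rpow_const fun x => Or.inl (wW_pos x).ne'

lemma continuous_eW (s : ℝ) : Continuous (eW s : V → ℝ≥0∞) :=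
  ENNReal.continuous_ofReal.comp (continuous_wW_rpow s)

lemma eW_neg_mul (s : ℝ) (x : V) : eW (-s) x * eW s x = 1 := by
  unfold eW
  rw [← ENNReal.ofReal_mul (Real.rpow_nonneg (wW_pos x).le _), ← Real.rpow_add (wW_pos x)]
  simp

lemma eW_add (s t : ℝ) (x : V) : eW s x * eW t x = eW (s + t) x := by
  unfold eW
  rw [← ENNReal.ofReal_mul (Real.rpow_nonneg (wW_pos x).le _), ← Real.rpow_add (wW_pos x)]

lemma eW_rpow (s t : ℝ) (ht : 0 ≤ t) (x : V) : eW s x ^ t = eW (s * t) x := by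
  unfold eW
  rw [ENNReal.ofReal_rpow_of_nonneg (Real.rpow_nonneg (wW_pos x).le _) ht,
    ← Real.rpow_mul (wW_pos x).le]

lemma eW_sq (s : ℝ) (x : V) : eW s x ^ 2 = eW (s * 2) x := by
  rw [sq, eW_add]; congr 1; ring

lemma eW_peetre {s : ℝ} (hs : 0 ≤ s) (x y : V) :
    eW s x ≤ ENNReal.ofReal (2 ^ s) * (eW s y * eW s (x - y)) := by
  unfold eW
  rw [← ENNReal.ofReal_mul (Real.rpow_nonneg (wW_pos y).le _), ← ENNReal.ofReal_mul (by positivity)]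
  exact ENNReal.ofReal_le_ofReal (wW_rpow_peetre hs x y)

lemma eW_neg (s : ℝ) (x : V) : eW s (-x) = eW s x := by unfold eW; rw [wW_neg]

lemma enorm_wW (s : ℝ) (x : V) : ‖((wW x ^ s : ℝ) : ℂ)‖ₑ = eW s x := by
  unfold eW
  rw [← ofReal_norm, Complex.norm_real, Real.norm_of_nonneg (Real.rpow_nonneg (wW_pos x).le _)]

lemma tg_wW (s : ℝ) : (fun x : V => ((wW x ^ s : ℝ) : ℂ)).HasTemperateGrowth := by
  have := Function.hasTemperateGrowth_one_add_norm_sq_rpow V s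
  unfold wW
  fun_prop

/-- Multiplication of a Schwartz function by a power of the weight. -/
noncomputable def mW (s : ℝ) : 𝓢(V, ℂ) →L[ℂ] 𝓢(V, ℂ) :=
  smulLeftCLM ℂ (fun x : V => ((wW x ^ s : ℝ) : ℂ))

lemma mW_apply (s : ℝ) (f : 𝓢(V, ℂ)) (x : V) : mW s f x = ((wW x ^ s : ℝ) : ℂ) * f x := by
  unfold mW
  rw [smulLeftCLM_apply_apply (tg_wW s)]; rfl

/-- Product of Schwartz functions. -/
noncomputable def pr (f g : 𝓢(V, ℂ)) : 𝓢(V, ℂ) := pairing (ContinuousLinearMap.mul ℂ ℂ) f g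

lemma pr_apply (f g : 𝓢(V, ℂ)) (x : V) : pr f g x = f x * g x := rfl

/-- Translate. -/
noncomputable def tr (y : V) (f : 𝓢(V, ℂ)) : 𝓢(V, ℂ) := f.compSubConstCLM ℂ y

lemma tr_apply (y : V) (f : 𝓢(V, ℂ)) (x : V) : tr y f x = f (x - y) := rfl

/-- Derivative bounds for powers of the weight. -/
lemma iteratedFDeriv_wW_le (n : ℕ) : ∀ e : ℝ, ∃ C : ℝ, 0 ≤ C ∧ ∀ x : V,
    ‖iteratedFDeriv ℝ n (fun x : V => wW x ^ e) x‖ ≤ C * wW x ^ e := by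
  induction n using Nat.strong_induction_on with
  | _ n ih =>
  intro e
  rcases n with _ | n
  · refine ⟨1, zero_le_one, fun x => ?_⟩
    rw [norm_iteratedFDeriv_zero, one_mul, Real.norm_of_nonneg (Real.rpow_nonneg (wW_pos x).le _)]
  · have hd : fderiv ℝ (fun x : V => wW x ^ e) =
        fun x => (wW x ^ (e - 1)) • ((2 * e) • innerSL ℝ : V →L[ℝ] V →L[ℝ] ℝ) x := by
      funext x
      have h1 : HasFDerivAt (wW : V → ℝ) ((2 : ℝ) • innerSL ℝ x) x := by
        have := ((hasStrictFDerivAt_norm_sq x).hasFDerivAt).const_add 1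
        have h0 : (2 • innerSL ℝ x : V →L[ℝ] ℝ) = (2 : ℝ) • innerSL ℝ x := by
          ext v; simp
        rw [h0] at this
        exact this
      have h2 := h1.rpow_const (p := e) (Or.inl (wW_pos x).ne')
      rw [h2.fderiv]
      ext v
      simp
      ring
    set L : V →L[ℝ] V →L[ℝ] ℝ := (2 * e) • innerSL ℝ with hL
    choose! C hC0 hC using ih
    refine ⟨∑ i ∈ Finset.range (n + 1), n.choose i * C i (e - 1) * ‖L‖, ?_, fun x => ?_⟩
    · refine Finset.sum_nonneg fun i hi => ?_
      have := hC0 i (by simpa using hi) (e - 1)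
      positivity
    rw [← norm_iteratedFDeriv_fderiv, hd]
    have hsm : ContDiff ℝ n (fun x : V => wW x ^ (e - 1)) := by
      have : ContDiff ℝ n (wW : V → ℝ) := contDiff_const.add (contDiff_norm_sq ℝ)
      exact this.rpow_const_of_ne fun x => (wW_pos x).ne'
    refine (norm_iteratedFDeriv_smul_le (hsm) (L.contDiff (n := n)) x le_rfl).trans ?_
    rw [Finset.sum_mul]
    refine Finset.sum_le_sum fun i hi => ?_
    have hx : ‖x‖ ≤ wW x := by unfold wW; nlinarith [sq_nonneg (‖x‖ - 1)]
    have h3 : ‖iteratedFDeriv ℝ (n - i) L x‖ ≤ ‖L‖ * wW x := by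
      have hf : fderiv ℝ L = fun _ => L := by ext1 v; simp only [ContinuousLinearMap.fderiv]
      rcases n - i with _ | _ | k
      · rw [norm_iteratedFDeriv_zero]
        exact (L.le_opNorm x).trans (by gcongr)
      · rw [← norm_iteratedFDeriv_fderiv, hf, norm_iteratedFDeriv_zero]
        exact le_mul_of_one_le_right (norm_nonneg _) (one_le_wW x)
      · rw [← norm_iteratedFDeriv_fderiv, hf, iteratedFDeriv_const_of_ne (by simp)]
        have := wW_pos x
        simp only [Pi.zero_apply, norm_zero]
        positivity
    have h4 := hC i (by simpa using hi) (e - 1) x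
    have h6 := hC0 i (by simpa using hi) (e - 1)
    have h7 := Real.rpow_nonneg (wW_pos x).le (e - 1)
    have h5 : wW x ^ e = wW x ^ (e - 1) * wW x := by
      rw [← Real.rpow_add_one (wW_pos x).ne']; ring_nf
    rw [h5]
    calc _ ≤ n.choose i * (C i (e - 1) * wW x ^ (e - 1)) * (‖L‖ * wW x) := by gcongr
      _ = _ := by ring


/-- Schwartz decay against real powers of the weight. -/
lemma schwartz_weight_bound (φ : 𝓢(V, ℂ)) (e : ℝ) (k j : ℕ) : ∃ M : ℝ, 0 ≤ M ∧ ∀ u : V,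
    wW u ^ e * (‖u‖ ^ k * ‖iteratedFDeriv ℝ j φ u‖) ≤ M := by
  obtain ⟨m, hm⟩ := exists_nat_ge e
  refine ⟨2 ^ (2 * m + k) * (Finset.Iic (2 * m + k, j)).sup
    (fun m => SchwartzMap.seminorm ℝ m.1 m.2) φ, by positivity, fun u => ?_⟩
  refine le_trans ?_ (one_add_le_sup_seminorm_apply (𝕜 := ℝ) (m := (2 * m + k, j))
    (le_refl (2 * m + k)) (le_refl j) φ u)
  rw [← mul_assoc]
  gcongr
  rw [pow_add, pow_mul]
  have h1 : wW u ^ e ≤ ((1 + ‖u‖) ^ 2) ^ m := by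
    calc wW u ^ e ≤ wW u ^ (m : ℝ) := Real.rpow_le_rpow_of_exponent_le (one_le_wW u) hm
      _ = wW u ^ m := Real.rpow_natCast _ _
      _ ≤ _ := by
        refine pow_le_pow_left₀ (wW_pos u).le ?_ m
        unfold wW; nlinarith [norm_nonneg u]
  have h2 : ‖u‖ ^ k ≤ (1 + ‖u‖) ^ k := by gcongr; linarith
  gcongr

lemma seminorm_tr_mW_le (φ : 𝓢(V, ℂ)) {e : ℝ} (he : 0 ≤ e) (k n : ℕ) : ∃ M : ℝ, 0 ≤ M ∧ ∀ y : V,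
    SchwartzMap.seminorm ℂ k n (tr (-y) (mW e (tr y φ))) ≤ M * wW y ^ e := by
  choose C hC0 hC using fun i => iteratedFDeriv_wW_le (V := V) i e
  choose D hD0 hD using fun j => schwartz_weight_bound φ e k j
  have hnn : 0 ≤ ∑ i ∈ Finset.range (n + 1), n.choose i * C i * 2 ^ e * D (n - i) := by
    refine Finset.sum_nonneg fun i _ => ?_
    have := hC0 i; have := hD0 (n - i); positivity
  refine ⟨_, hnn, fun y => ?_⟩
  have hy := wW_pos y
  refine seminorm_le_bound ℂ k n _ (by positivity) fun u => ?_
  have heq : (tr (-y) (mW e (tr y φ)) : V → ℂ) = fun u => (wW (u + y) ^ e) • φ u := by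
    funext u
    rw [tr_apply, mW_apply, tr_apply]
    simp
  rw [heq]
  have hsm : ContDiff ℝ n (fun u : V => wW (u + y) ^ e) := by
    have h1 : ContDiff ℝ n (wW : V → ℝ) := contDiff_const.add (contDiff_norm_sq ℝ)
    have h2 : ContDiff ℝ n (fun u : V => wW (u + y)) := h1.comp (contDiff_id.add contDiff_const)
    exact h2.rpow_const_of_ne fun x => (wW_pos _).ne'
  have h0 := norm_iteratedFDeriv_smul_le hsm (φ.smooth n) u le_rfl
  refine (mul_le_mul_of_nonneg_left h0 (by positivity)).trans ?_
  rw [Finset.mul_sum, Finset.sum_mul]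
  refine Finset.sum_le_sum fun i _ => ?_
  have h1 : ‖iteratedFDeriv ℝ i (fun u : V => wW (u + y) ^ e) u‖ ≤
      C i * (2 ^ e * (wW y ^ e * wW u ^ e)) := by
    rw [iteratedFDeriv_comp_add_right (f := fun u : V => wW u ^ e)]
    refine (hC i (u + y)).trans ?_
    have := wW_rpow_peetre he (u + y) y
    rw [add_sub_cancel_right] at this
    exact mul_le_mul_of_nonneg_left this (hC0 i)
  have h2 := hD (n - i) u
  have h3 := hC0 i
  calc ‖u‖ ^ k * (n.choose i * ‖iteratedFDeriv ℝ i (fun u : V => wW (u + y) ^ e) u‖ *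
        ‖iteratedFDeriv ℝ (n - i) φ u‖)
      ≤ ‖u‖ ^ k * (n.choose i * (C i * (2 ^ e * (wW y ^ e * wW u ^ e))) *
        ‖iteratedFDeriv ℝ (n - i) φ u‖) := by gcongr
    _ = n.choose i * C i * 2 ^ e * wW y ^ e *
        (wW u ^ e * (‖u‖ ^ k * ‖iteratedFDeriv ℝ (n - i) φ u‖)) := by ring
    _ ≤ n.choose i * C i * 2 ^ e * wW y ^ e * D (n - i) := by gcongr
    _ = _ := by ring

variable [FiniteDimensional ℝ V] [MeasurableSpace V] [BorelSpace V]

lemma fourier_tr (y : V) (f : 𝓢(V, ℂ)) (ξ : V) :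
    𝓕 (tr y f) ξ = (Real.fourierChar (-(inner ℝ y ξ)) : ℂ) * 𝓕 f ξ := by
  have h := congrFun (VectorFourier.fourierIntegral_comp_add_right Real.fourierChar volume
    (innerₗ V) f (-y)) ξ
  have h2 : (f ∘ fun v => v + -y) = tr y f := by
    funext x; simp [tr_apply, sub_eq_add_neg]
  rw [h2] at h
  have h3 : (innerₗ V) (-y) ξ = -(inner ℝ y ξ) := by simp
  rw [h3] at h
  refine h.trans ?_
  rw [Circle.smul_def, smul_eq_mul]
  rfl

lemma enorm_fourier_tr (y : V) (f : 𝓢(V, ℂ)) (ξ : V) : ‖𝓕 (tr y f) ξ‖ₑ = ‖𝓕 f ξ‖ₑ := by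
  have h : ‖(Real.fourierChar (-(inner ℝ y ξ)) : ℂ)‖ₑ = 1 := by
    rw [← ofReal_norm, Circle.norm_coe, ENNReal.ofReal_one]
  rw [fourier_tr, enorm_mul, h, one_mul]

lemma fourier_fourier_apply (f : 𝓢(V, ℂ)) (x : V) : 𝓕 (𝓕 f) x = f (-x) := by
  have h : 𝓕⁻ (𝓕 f) (-x) = f (-x) := by simp
  rw [← h, fourierInv_coe, Real.fourierInv_eq_fourier_neg, neg_neg]
  rfl

lemma fourier_pr (f g : 𝓢(V, ℂ)) (ξ : V) :
    𝓕 (pr f g) ξ = ∫ η, 𝓕 f η * 𝓕 g (ξ - η) := by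
  have h := convolution_apply (ContinuousLinearMap.mul ℂ ℂ) (𝓕 f) (𝓕 g) ξ
  rw [MeasureTheory.convolution] at h
  simp only [ContinuousLinearMap.mul_apply'] at h
  rw [← h]
  have h2 := fourier_convolution (ContinuousLinearMap.mul ℂ ℂ) (𝓕 f) (𝓕 g)
  have h3 : 𝓕 (SchwartzMap.convolution (ContinuousLinearMap.mul ℂ ℂ) (𝓕 f) (𝓕 g)) =
      𝓕 (𝓕 (pr f g)) := by
    rw [h2]
    ext x
    rw [fourier_fourier_apply, pr_apply, pairing_apply_apply, fourier_fourier_apply,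
      fourier_fourier_apply]
    rfl
  have h4 := congrArg (fun F : 𝓢(V, ℂ) => 𝓕⁻ F) h3
  simp only [FourierTransform.fourierInv_fourier_eq] at h4
  rw [h4]

lemma lintegral_sq_eq (f : 𝓢(V, ℂ)) :
    ∫⁻ x, ‖f x‖ₑ ^ 2 = ENNReal.ofReal (∫ x, ‖f x‖ ^ 2) := by
  rw [ofReal_integral_eq_lintegral_ofReal]
  · congr 1; funext x
    rw [ENNReal.ofReal_pow (norm_nonneg _), ofReal_norm]
  · exact (f.memLp 2 volume).integrable_norm_pow (by norm_num)
  · exact Filter.Eventually.of_forall fun x => by positivity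

lemma plancherel (f : 𝓢(V, ℂ)) : ∫⁻ ξ, ‖𝓕 f ξ‖ₑ ^ 2 = ∫⁻ x, ‖f x‖ₑ ^ 2 := by
  rw [lintegral_sq_eq, lintegral_sq_eq, integral_norm_sq_fourier]

lemma plancherel_inv (f : 𝓢(V, ℂ)) : ∫⁻ ξ, ‖𝓕⁻ f ξ‖ₑ ^ 2 = ∫⁻ x, ‖f x‖ₑ ^ 2 := by
  rw [← plancherel]; simp

lemma lintegral_weight_sq (s : ℝ) (f : 𝓢(V, ℂ)) :
    ∫⁻ x, eW s x * ‖f x‖ₑ ^ 2 = ∫⁻ x, ‖mW (s / 2) f x‖ₑ ^ 2 := by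
  congr 1; funext x
  rw [mW_apply, enorm_mul, enorm_wW, mul_pow, eW_sq]; congr 2; ring

lemma lintegral_weight_sq_ne_top (s : ℝ) (f : 𝓢(V, ℂ)) :
    ∫⁻ x, eW s x * ‖f x‖ₑ ^ 2 ≠ ⊤ := by
  rw [lintegral_weight_sq, lintegral_sq_eq]; exact ENNReal.ofReal_ne_top

/-- Uniform bound for the localised weights. -/
lemma unif_bound (φ : 𝓢(V, ℂ)) {e : ℝ} (he : 0 ≤ e) (s : ℝ) : ∃ C : ℝ≥0∞, C ≠ ⊤ ∧ ∀ y : V,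
    ∫⁻ ξ, eW s ξ * ‖𝓕 (mW e (tr y φ)) ξ‖ₑ ≤ C * eW e y := by
  let N : V → 𝓢(V, ℂ) := fun y => ((wW y ^ (-e) : ℝ) : ℂ) • tr (-y) (mW e (tr y φ))
  have hN : Bornology.IsVonNBounded ℂ (Set.range N) := by
    rw [(schwartz_withSeminorms ℂ V ℂ).isVonNBounded_iff_seminorm_bounded]
    rintro ⟨k, n⟩
    obtain ⟨M, hM0, hM⟩ := seminorm_tr_mW_le φ he k n
    refine ⟨M + 1, by positivity, ?_⟩
    rintro _ ⟨y, rfl⟩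
    simp only [N, schwartzSeminormFamily_apply]
    rw [map_smul_eq_mul, Complex.norm_real,
      Real.norm_of_nonneg (Real.rpow_nonneg (wW_pos y).le _)]
    have h1 : wW y ^ (-e) * wW y ^ e = 1 := by
      rw [← Real.rpow_add (wW_pos y)]; simp
    have h2 := mul_le_mul_of_nonneg_left (hM y) (Real.rpow_nonneg (wW_pos y).le (-e))
    nlinarith
  let T : 𝓢(V, ℂ) →L[ℂ] Lp ℂ 1 (volume : Measure V) :=
    (toLpCLM ℂ ℂ 1 volume) ∘L (mW s) ∘L (fourierCLM ℂ 𝓢(V, ℂ))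
  have hT := hN.image T
  rw [NormedSpace.isVonNBounded_iff'] at hT
  obtain ⟨r, hr⟩ := hT
  refine ⟨ENNReal.ofReal r, ENNReal.ofReal_ne_top, fun y => ?_⟩
  have h1 : ‖(mW s (𝓕 (N y))).toLp 1‖ ≤ r := hr _ ⟨N y, ⟨y, rfl⟩, rfl⟩
  have h2 : ∫⁻ ξ, eW s ξ * ‖𝓕 (N y) ξ‖ₑ ≤ ENNReal.ofReal r := by
    have h3 := ENNReal.ofReal_le_ofReal h1
    rw [norm_toLp_one, ofReal_integral_eq_lintegral_ofReal (mW s (𝓕 (N y))).integrable.norm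
      (Filter.Eventually.of_forall fun x => norm_nonneg _)] at h3
    refine le_trans (le_of_eq ?_) h3
    congr 1; funext ξ
    rw [ofReal_norm, mW_apply, enorm_mul, enorm_wW]
  have h4 : ∀ ξ, ‖𝓕 (mW e (tr y φ)) ξ‖ₑ = eW e y * ‖𝓕 (N y) ξ‖ₑ := by
    intro ξ
    simp only [N]
    rw [FourierTransform.fourier_smul, smul_apply, smul_eq_mul, enorm_mul, enorm_wW,
      enorm_fourier_tr, ← mul_assoc, mul_comm (eW e y), eW_neg_mul, one_mul]
  calc ∫⁻ ξ, eW s ξ * ‖𝓕 (mW e (tr y φ)) ξ‖ₑ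
      = ∫⁻ ξ, eW e y * (eW s ξ * ‖𝓕 (N y) ξ‖ₑ) := by
        congr 1; funext ξ; rw [h4]; ring
    _ = eW e y * ∫⁻ ξ, eW s ξ * ‖𝓕 (N y) ξ‖ₑ := by
        refine lintegral_const_mul' _ _ ENNReal.ofReal_ne_top
    _ ≤ _ := by rw [mul_comm]; gcongr


lemma fourierInv_apply_neg (f : 𝓢(V, ℂ)) (x : V) : 𝓕⁻ f x = 𝓕 f (-x) := by
  rw [fourierInv_coe, Real.fourierInv_eq_fourier_neg]; rfl

lemma stft_eq (f φ : 𝓢(V, ℂ)) (y ξ : V) : 𝓕 (pr f (tr y φ)) ξ =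
    ∫ η, 𝓕 f η * ((Real.fourierChar (-(inner ℝ y (ξ - η))) : ℂ) * 𝓕 φ (ξ - η)) := by
  rw [fourier_pr]
  simp_rw [fourier_tr]

lemma stft_measurable (f φ : 𝓢(V, ℂ)) :
    Measurable (fun z : V × V => ‖𝓕 (pr f (tr z.1 φ)) z.2‖ₑ ^ 2) := by
  have h : StronglyMeasurable (fun z : V × V => 𝓕 (pr f (tr z.1 φ)) z.2) := by
    simp_rw [stft_eq]
    have hc : Continuous (fun w : (V × V) × V => 𝓕 f w.2 *
        ((Real.fourierChar (-(inner ℝ w.1.1 (w.1.2 - w.2))) : ℂ) * 𝓕 φ (w.1.2 - w.2))) := by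
      have h1 := (𝓕 f).continuous
      have h2 := (𝓕 φ).continuous
      have h3 : Continuous (fun t : ℝ => (Real.fourierChar t : ℂ)) :=
        continuous_subtype_val.comp Real.continuous_fourierChar
      refine (h1.comp (by fun_prop)).mul ((h3.comp (by fun_prop)).mul (h2.comp (by fun_prop)))
    exact hc.stronglyMeasurable.integral_prod_right'
  exact h.measurable.enorm.pow_const 2

lemma stft_plancherel (f φ : 𝓢(V, ℂ)) (ξ : V) :
    ∫⁻ y, ‖𝓕 (pr f (tr y φ)) ξ‖ₑ ^ 2 = ∫⁻ η, ‖𝓕 f η‖ₑ ^ 2 * ‖𝓕 φ (ξ - η)‖ₑ ^ 2 := by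
  have h1 : ∀ y, ‖𝓕 (pr f (tr y φ)) ξ‖ₑ = ‖𝓕⁻ (pr (𝓕 f) (tr ξ (𝓕⁻ φ))) y‖ₑ := by
    intro y
    have h2 : 𝓕 (pr f (tr y φ)) ξ = (Real.fourierChar (-(inner ℝ y ξ)) : ℂ) *
        𝓕⁻ (pr (𝓕 f) (tr ξ (𝓕⁻ φ))) y := by
      rw [stft_eq, fourierInv_coe, Real.fourierInv_eq, ← integral_const_mul]
      congr 1; funext η
      rw [pr_apply, tr_apply, fourierInv_apply_neg, neg_sub, Circle.smul_def, smul_eq_mul,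
        inner_sub_right, neg_sub, sub_eq_add_neg, AddChar.map_add_eq_mul, real_inner_comm η y]
      push_cast
      ring
    have h : ‖(Real.fourierChar (-(inner ℝ y ξ)) : ℂ)‖ₑ = 1 := by
      rw [← ofReal_norm, Circle.norm_coe, ENNReal.ofReal_one]
    rw [h2, enorm_mul, h, one_mul]
  simp_rw [h1]
  rw [plancherel_inv]
  congr 1; funext η
  rw [pr_apply, tr_apply, fourierInv_apply_neg, neg_sub, enorm_mul, mul_pow]

lemma eW_ne_top (s : ℝ) (x : V) : eW s x ≠ ⊤ := ENNReal.ofReal_ne_top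

lemma meas_sq (f : 𝓢(V, ℂ)) : Measurable (fun x => ‖f x‖ₑ ^ 2) :=
  (f.continuous.measurable.enorm).pow_const 2

lemma meas_eW (s : ℝ) : Measurable (eW s : V → ℝ≥0∞) := (continuous_eW s).measurable

lemma stft_fubini (f φ : 𝓢(V, ℂ)) (s : ℝ) :
    ∫⁻ ξ, ∫⁻ y, eW s ξ * ‖𝓕 (pr f (tr y φ)) ξ‖ₑ ^ 2 =
      ∫⁻ η, ‖𝓕 f η‖ₑ ^ 2 * ∫⁻ ξ, eW s ξ * ‖𝓕 φ (ξ - η)‖ₑ ^ 2 := by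
  have h1 : ∀ ξ, ∫⁻ y, eW s ξ * ‖𝓕 (pr f (tr y φ)) ξ‖ₑ ^ 2 =
      ∫⁻ η, ‖𝓕 f η‖ₑ ^ 2 * (eW s ξ * ‖𝓕 φ (ξ - η)‖ₑ ^ 2) := by
    intro ξ
    rw [lintegral_const_mul' _ _ (eW_ne_top _ _), stft_plancherel,
      ← lintegral_const_mul' _ _ (eW_ne_top _ _)]
    congr 1; funext η; ring
  simp_rw [h1]
  rw [lintegral_lintegral_swap]
  · congr 1; funext η
    rw [lintegral_const_mul' _ _ (by simp)]
  · refine Measurable.aemeasurable ?_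
    have a := meas_sq (𝓕 f)
    have b := meas_sq (𝓕 φ)
    have c := meas_eW (V := V) s
    exact (a.comp measurable_snd).mul ((c.comp measurable_fst).mul
      (b.comp (measurable_fst.sub measurable_snd)))

/-- Upper bound (B). -/
lemma stft_upper (f φ : 𝓢(V, ℂ)) {s : ℝ} (hs : 0 ≤ s) :
    ∫⁻ ξ, ∫⁻ y, eW s ξ * ‖𝓕 (pr f (tr y φ)) ξ‖ₑ ^ 2 ≤
      (ENNReal.ofReal (2 ^ s) * ∫⁻ ξ, eW s ξ * ‖𝓕 φ ξ‖ₑ ^ 2) * ∫⁻ η, eW s η * ‖𝓕 f η‖ₑ ^ 2 := by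
  have hK := lintegral_weight_sq_ne_top s (𝓕 φ)
  rw [stft_fubini, ← lintegral_const_mul' _ _ (ENNReal.mul_ne_top ENNReal.ofReal_ne_top hK)]
  refine lintegral_mono fun η => ?_
  have : ∫⁻ ξ, eW s ξ * ‖𝓕 φ (ξ - η)‖ₑ ^ 2 ≤
      (ENNReal.ofReal (2 ^ s) * eW s η) * ∫⁻ ξ, eW s ξ * ‖𝓕 φ ξ‖ₑ ^ 2 := by
    rw [← lintegral_sub_right_eq_self (fun ξ => eW s ξ * ‖𝓕 φ ξ‖ₑ ^ 2) η,
      ← lintegral_const_mul' _ _ (ENNReal.mul_ne_top ENNReal.ofReal_ne_top (eW_ne_top _ _))]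
    refine lintegral_mono fun ξ => ?_
    refine (mul_le_mul_left (eW_peetre hs ξ η) _).trans (le_of_eq ?_)
    ring
  refine (mul_le_mul_right this _).trans (le_of_eq ?_)
  ring

/-- Lower bound (C). -/
lemma stft_lower (f φ : 𝓢(V, ℂ)) {s : ℝ} (hs : 0 ≤ s) :
    (∫⁻ ξ, eW (-s) ξ * ‖𝓕 φ ξ‖ₑ ^ 2) * ∫⁻ η, eW s η * ‖𝓕 f η‖ₑ ^ 2 ≤
    ENNReal.ofReal (2 ^ s) * ∫⁻ ξ, ∫⁻ y, eW s ξ * ‖𝓕 (pr f (tr y φ)) ξ‖ₑ ^ 2 := by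
  have hK := lintegral_weight_sq_ne_top (-s) (𝓕 φ)
  rw [stft_fubini, ← lintegral_const_mul' _ _ hK, ← lintegral_const_mul' _ _ ENNReal.ofReal_ne_top]
  refine lintegral_mono fun η => ?_
  have : eW s η * ∫⁻ ξ, eW (-s) ξ * ‖𝓕 φ ξ‖ₑ ^ 2 ≤
      ENNReal.ofReal (2 ^ s) * ∫⁻ ξ, eW s ξ * ‖𝓕 φ (ξ - η)‖ₑ ^ 2 := by
    rw [← lintegral_sub_right_eq_self (fun ξ => eW (-s) ξ * ‖𝓕 φ ξ‖ₑ ^ 2) η,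
      ← lintegral_const_mul' _ _ (eW_ne_top _ _),
      ← lintegral_const_mul' _ _ ENNReal.ofReal_ne_top]
    refine lintegral_mono fun ξ => ?_
    have h1 := eW_peetre hs η ξ
    have h2 : eW s (η - ξ) = eW s (ξ - η) := by rw [← eW_neg, neg_sub]
    rw [h2] at h1
    refine (mul_le_mul_left h1 _).trans (le_of_eq ?_)
    calc _ = ENNReal.ofReal (2 ^ s) * (eW s ξ * ‖𝓕 φ (ξ - η)‖ₑ ^ 2) *
          (eW (-s) (ξ - η) * eW s (ξ - η)) := by ring
      _ = _ := by rw [eW_neg_mul, mul_one]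
  calc _ = (eW s η * ∫⁻ ξ, eW (-s) ξ * ‖𝓕 φ ξ‖ₑ ^ 2) * ‖𝓕 f η‖ₑ ^ 2 := by ring
    _ ≤ (ENNReal.ofReal (2 ^ s) * ∫⁻ ξ, eW s ξ * ‖𝓕 φ (ξ - η)‖ₑ ^ 2) * ‖𝓕 f η‖ₑ ^ 2 := by gcongr
    _ = _ := by ring

/-- Young-type inequality. -/
lemma young_sq {A B : V → ℝ≥0∞} (hA : Measurable A) (hB : Measurable B) :
    ∫⁻ ξ, (∫⁻ η, A η * B (ξ - η)) ^ 2 ≤ (∫⁻ η, A η) ^ 2 * ∫⁻ η, B η ^ 2 := by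
  have h1 : ∀ ξ, (∫⁻ η, A η * B (ξ - η)) ^ 2 ≤ (∫⁻ η, A η) * ∫⁻ η, A η * B (ξ - η) ^ 2 := by
    intro ξ
    have hm : Measurable fun η => B (ξ - η) := hB.comp (measurable_const.sub measurable_id)
    have h := ENNReal.lintegral_mul_norm_pow_le (μ := (volume : Measure V)) (f := A)
      (g := fun η => A η * B (ξ - η) ^ 2) hA.aemeasurable
      (hA.mul (hm.pow_const 2)).aemeasurable (p := 1 / 2) (q := 1 / 2)
      (by norm_num) (by norm_num) (by norm_num)
    have h2 : ∀ η, A η ^ (1 / 2 : ℝ) * (A η * B (ξ - η) ^ 2) ^ (1 / 2 : ℝ) = A η * B (ξ - η) := by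
      intro η
      rw [ENNReal.mul_rpow_of_nonneg _ _ (by norm_num), ← mul_assoc,
        ← ENNReal.rpow_add_of_nonneg _ _ (by norm_num) (by norm_num), ← ENNReal.rpow_natCast,
        ← ENNReal.rpow_mul]
      norm_num
    simp_rw [h2] at h
    rw [← ENNReal.mul_rpow_of_nonneg _ _ (by norm_num)] at h
    calc _ ≤ (((∫⁻ η, A η) * ∫⁻ η, A η * B (ξ - η) ^ 2) ^ (1 / 2 : ℝ)) ^ 2 := by gcongr
      _ = _ := by
        rw [← ENNReal.rpow_natCast, ← ENNReal.rpow_mul]; norm_num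
  refine (lintegral_mono h1).trans ?_
  have hm2 : Measurable (fun z : V × V => A z.2 * B (z.1 - z.2) ^ 2) :=
    (hA.comp measurable_snd).mul ((hB.comp (measurable_fst.sub measurable_snd)).pow_const 2)
  rw [lintegral_const_mul _ hm2.lintegral_prod_right', lintegral_lintegral_swap hm2.aemeasurable,
    sq, mul_assoc]
  gcongr
  rw [← lintegral_mul_const _ hA]
  refine lintegral_mono fun η => ?_
  have hm3 : Measurable fun x => B (x - η) ^ 2 :=
    (hB.comp (measurable_id.sub measurable_const)).pow_const 2
  change ∫⁻ x, A η * B (x - η) ^ 2 ≤ _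
  rw [lintegral_const_mul _ hm3]
  exact le_of_eq (congrArg _ (lintegral_sub_right_eq_self (fun ξ => B ξ ^ 2) η))

/-- Multiplication estimate (D). -/
lemma mult_bound (m h : 𝓢(V, ℂ)) {s : ℝ} (hs : 0 ≤ s) :
    ∫⁻ ξ, eW s ξ * ‖𝓕 (pr m h) ξ‖ₑ ^ 2 ≤
      ENNReal.ofReal (2 ^ s) * (∫⁻ ξ, eW (s / 2) ξ * ‖𝓕 m ξ‖ₑ) ^ 2 *
        ∫⁻ ξ, eW s ξ * ‖𝓕 h ξ‖ₑ ^ 2 := by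
  set c := ENNReal.ofReal (2 ^ (s / 2)) with hc
  have hc2 : c ^ 2 = ENNReal.ofReal (2 ^ s) := by
    rw [hc, ← ENNReal.ofReal_pow (by positivity), ← Real.rpow_natCast, ← Real.rpow_mul (by norm_num)]
    norm_num
  have hct : c ≠ ⊤ := ENNReal.ofReal_ne_top
  have hmA : Measurable fun ξ => eW (s / 2) ξ * ‖𝓕 m ξ‖ₑ :=
    (meas_eW _).mul (𝓕 m).continuous.measurable.enorm
  have hmB : Measurable fun ξ => eW (s / 2) ξ * ‖𝓕 h ξ‖ₑ :=
    (meas_eW _).mul (𝓕 h).continuous.measurable.enorm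
  have key : ∀ ξ, eW (s / 2) ξ * ‖𝓕 (pr m h) ξ‖ₑ ≤
      c * ∫⁻ η, (eW (s / 2) η * ‖𝓕 m η‖ₑ) * (eW (s / 2) (ξ - η) * ‖𝓕 h (ξ - η)‖ₑ) := by
    intro ξ
    rw [fourier_pr]
    refine (mul_le_mul_right (enorm_integral_le_lintegral_enorm _) _).trans ?_
    rw [← lintegral_const_mul' _ _ (eW_ne_top _ _), ← lintegral_const_mul' _ _ hct]
    refine lintegral_mono fun η => ?_
    rw [enorm_mul]
    refine (mul_le_mul_left (eW_peetre (by positivity : 0 ≤ s / 2) ξ η) _).trans (le_of_eq ?_)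
    ring
  have hsq : ∀ (g : 𝓢(V, ℂ)) ξ, eW s ξ * ‖𝓕 g ξ‖ₑ ^ 2 = (eW (s / 2) ξ * ‖𝓕 g ξ‖ₑ) ^ 2 := by
    intro g ξ
    rw [mul_pow, eW_sq]; congr 2; ring
  simp_rw [hsq]
  calc _ ≤ ∫⁻ ξ, c ^ 2 * (∫⁻ η, (eW (s / 2) η * ‖𝓕 m η‖ₑ) *
          (eW (s / 2) (ξ - η) * ‖𝓕 h (ξ - η)‖ₑ)) ^ 2 := by
        refine lintegral_mono fun ξ => ?_
        rw [← mul_pow]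
        exact pow_le_pow_left₀ (by simp) (key ξ) 2
    _ = c ^ 2 * ∫⁻ ξ, (∫⁻ η, (eW (s / 2) η * ‖𝓕 m η‖ₑ) *
          (eW (s / 2) (ξ - η) * ‖𝓕 h (ξ - η)‖ₑ)) ^ 2 :=
        lintegral_const_mul' _ _ (ENNReal.pow_ne_top hct)
    _ ≤ c ^ 2 * ((∫⁻ ξ, eW (s / 2) ξ * ‖𝓕 m ξ‖ₑ) ^ 2 * ∫⁻ ξ, (eW (s / 2) ξ * ‖𝓕 h ξ‖ₑ) ^ 2) :=
        mul_le_mul_right (young_sq hmA hmB) _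
    _ = _ := by rw [hc2, mul_assoc]


lemma exists_schwartz_ne : ∃ φ : 𝓢(V, ℂ), φ 0 ≠ 0 := by
  let b : ContDiffBump (0 : V) := default
  have h1 : HasCompactSupport (fun x => ((b x : ℝ) : ℂ)) :=
    b.hasCompactSupport.comp_left (g := fun t : ℝ => (t : ℂ)) (by simp)
  have h2 : ContDiff ℝ (⊤ : ℕ∞) (fun x => ((b x : ℝ) : ℂ)) :=
    Complex.ofRealCLM.contDiff.comp b.contDiff
  refine ⟨h1.toSchwartzMap h2, ?_⟩
  have h3 : h1.toSchwartzMap h2 0 = ((b 0 : ℝ) : ℂ) := rfl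
  rw [h3, b.one_of_mem_closedBall (Metric.mem_closedBall_self b.rIn_pos.le)]
  simp

lemma lintegral_fourier_ne_zero (ψ : 𝓢(V, ℂ)) (h : ψ 0 ≠ 0) (s : ℝ) :
    ∫⁻ ξ, eW s ξ * ‖𝓕 ψ ξ‖ₑ ^ 2 ≠ 0 := by
  intro h0
  have hme : Measurable fun ξ => eW s ξ * ‖𝓕 ψ ξ‖ₑ ^ 2 := (meas_eW s).mul (meas_sq _)
  rw [lintegral_eq_zero_iff hme] at h0
  have h1 : ∫⁻ ξ, ‖𝓕 ψ ξ‖ₑ ^ 2 = 0 := by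
    rw [lintegral_eq_zero_iff (meas_sq _)]
    filter_upwards [h0] with ξ hξ
    simp only [Pi.zero_apply, mul_eq_zero] at hξ ⊢
    rcases hξ with hξ | hξ
    · exfalso
      have := eW_neg_mul s ξ
      rw [hξ] at this; simp at this
    · exact hξ
  rw [plancherel, lintegral_eq_zero_iff (meas_sq _)] at h1
  have h2 : (ψ : V → ℂ) =ᵐ[volume] (fun _ => 0) := by
    filter_upwards [h1] with x hx
    simpa using hx
  have h3 := Continuous.ae_eq_iff_eq volume ψ.continuous continuous_const |>.1 h2
  exact h (congrFun h3 0)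

/-- Weighted bound in the space variable (A). -/
lemma stft_space (f φ : 𝓢(V, ℂ)) {b : ℝ} (hb : 0 ≤ b) :
    ∫⁻ y, ∫⁻ ξ, eW b y * ‖𝓕 (pr f (tr y φ)) ξ‖ₑ ^ 2 ≤
      (ENNReal.ofReal (2 ^ b) * ∫⁻ x, eW b x * ‖φ x‖ₑ ^ 2) * ∫⁻ x, eW b x * ‖f x‖ₑ ^ 2 := by
  have hK := lintegral_weight_sq_ne_top b φ
  have h1 : ∀ y, ∫⁻ ξ, eW b y * ‖𝓕 (pr f (tr y φ)) ξ‖ₑ ^ 2 =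
      ∫⁻ x, ‖f x‖ₑ ^ 2 * (eW b y * ‖φ (x - y)‖ₑ ^ 2) := by
    intro y
    rw [lintegral_const_mul' _ _ (eW_ne_top _ _), plancherel,
      ← lintegral_const_mul' _ _ (eW_ne_top _ _)]
    congr 1; funext x
    rw [pr_apply, tr_apply, enorm_mul]; ring
  simp_rw [h1]
  rw [lintegral_lintegral_swap, ← lintegral_const_mul' _ _
    (ENNReal.mul_ne_top ENNReal.ofReal_ne_top hK)]
  · refine lintegral_mono fun x => ?_
    rw [lintegral_const_mul' _ _ (by simp)]
    have : ∫⁻ y, eW b y * ‖φ (x - y)‖ₑ ^ 2 ≤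
        (ENNReal.ofReal (2 ^ b) * eW b x) * ∫⁻ y, eW b y * ‖φ y‖ₑ ^ 2 := by
      rw [← lintegral_sub_left_eq_self (fun y => eW b y * ‖φ y‖ₑ ^ 2) x,
        ← lintegral_const_mul' _ _ (ENNReal.mul_ne_top ENNReal.ofReal_ne_top (eW_ne_top _ _))]
      refine lintegral_mono fun y => ?_
      have h2 := eW_peetre hb y x
      rw [show eW b (y - x) = eW b (x - y) by rw [← eW_neg, neg_sub]] at h2
      refine (mul_le_mul_left h2 _).trans (le_of_eq ?_)
      ring
    refine (mul_le_mul_right this _).trans (le_of_eq ?_)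
    ring
  · refine Measurable.aemeasurable ?_
    have a := meas_sq f
    have c := meas_sq φ
    have d := meas_eW (V := V) b
    exact (a.comp measurable_snd).mul ((d.comp measurable_fst).mul
      (c.comp (measurable_snd.sub measurable_fst)))

lemma meas_swap {F : V × V → ℝ≥0∞} (hF : Measurable F) : Measurable fun z : V × V => F (z.2, z.1) :=
  hF.comp (measurable_snd.prodMk measurable_fst)

lemma stft_swap (f φ : 𝓢(V, ℂ)) (s t : ℝ) :
    ∫⁻ ξ, ∫⁻ y, eW s ξ * (eW t y * ‖𝓕 (pr f (tr y φ)) ξ‖ₑ ^ 2) =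
    ∫⁻ y, ∫⁻ ξ, eW s ξ * (eW t y * ‖𝓕 (pr f (tr y φ)) ξ‖ₑ ^ 2) := by
  have h1 : Measurable fun z : V × V => ‖𝓕 (pr f (tr z.2 φ)) z.1‖ₑ ^ 2 :=
    meas_swap (stft_measurable f φ)
  have h2 : Measurable fun z : V × V => eW s z.1 := (meas_eW s).comp measurable_fst
  have h3 : Measurable fun z : V × V => eW t z.2 := (meas_eW t).comp measurable_snd
  have h4 : Measurable fun z : V × V => eW s z.1 * (eW t z.2 * ‖𝓕 (pr f (tr z.2 φ)) z.1‖ₑ ^ 2) :=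
    h2.mul (h3.mul h1)
  exact lintegral_lintegral_swap h4.aemeasurable

lemma eW_zero (x : V) : eW 0 x = 1 := by simp [eW]

/-- Hölder step. -/
lemma stft_holder (f φ : 𝓢(V, ℂ)) {a b α : ℝ} (h0 : 0 < α) (h1 : α < 1) :
    ∫⁻ y, ∫⁻ ξ, eW (α * a) ξ * (eW ((1 - α) * b) y * ‖𝓕 (pr f (tr y φ)) ξ‖ₑ ^ 2) ≤
      (∫⁻ y, ∫⁻ ξ, eW b y * ‖𝓕 (pr f (tr y φ)) ξ‖ₑ ^ 2) ^ (1 - α) *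
      (∫⁻ ξ, ∫⁻ y, eW a ξ * ‖𝓕 (pr f (tr y φ)) ξ‖ₑ ^ 2) ^ α := by
  have hS := stft_measurable f φ
  have m1 : Measurable fun z : V × V => eW b z.1 * ‖𝓕 (pr f (tr z.1 φ)) z.2‖ₑ ^ 2 :=
    ((meas_eW b).comp measurable_fst).mul hS
  have m2 : Measurable fun z : V × V => eW a z.2 * ‖𝓕 (pr f (tr z.1 φ)) z.2‖ₑ ^ 2 :=
    ((meas_eW a).comp measurable_snd).mul hS
  have m3 : Measurable fun z : V × V => eW (α * a) z.2 * (eW ((1 - α) * b) z.1 *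
      ‖𝓕 (pr f (tr z.1 φ)) z.2‖ₑ ^ 2) :=
    ((meas_eW _).comp measurable_snd).mul (((meas_eW _).comp measurable_fst).mul hS)
  have h := ENNReal.lintegral_mul_norm_pow_le (μ := (volume : Measure V).prod (volume : Measure V))
    m1.aemeasurable m2.aemeasurable (p := 1 - α) (q := α) (by linarith) h0.le (by ring)
  have hp : ∀ z : V × V, (eW b z.1 * ‖𝓕 (pr f (tr z.1 φ)) z.2‖ₑ ^ 2) ^ (1 - α) *
      (eW a z.2 * ‖𝓕 (pr f (tr z.1 φ)) z.2‖ₑ ^ 2) ^ α =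
      eW (α * a) z.2 * (eW ((1 - α) * b) z.1 * ‖𝓕 (pr f (tr z.1 φ)) z.2‖ₑ ^ 2) := by
    intro z
    have h1' : 0 ≤ 1 - α := by linarith
    generalize ‖𝓕 (pr f (tr z.1 φ)) z.2‖ₑ ^ 2 = S
    rw [ENNReal.mul_rpow_of_nonneg _ _ h1', ENNReal.mul_rpow_of_nonneg _ _ h0.le,
      eW_rpow _ _ h1', eW_rpow _ _ h0.le]
    calc _ = eW (b * (1 - α)) z.1 * eW (a * α) z.2 * (S ^ (1 - α) * S ^ α) := by ring
      _ = eW (b * (1 - α)) z.1 * eW (a * α) z.2 * S := by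
        rw [← ENNReal.rpow_add_of_nonneg _ _ h1' h0.le]; simp
      _ = _ := by rw [mul_comm b, mul_comm a]; ring
  simp_rw [hp] at h
  rw [lintegral_prod _ m1.aemeasurable, lintegral_prod _ m3.aemeasurable,
    lintegral_prod_symm _ m2.aemeasurable] at h
  exact h

/-- The main estimate on an arbitrary finite-dimensional inner product space. -/
lemma main_estimate {a b α : ℝ} (ha : 0 < a) (hb : 0 < b) (h0 : 0 < α) (h1 : α < 1) :
    ∃ C : ℝ≥0∞, C ≠ ⊤ ∧ ∀ f : 𝓢(V, ℂ),
      ∫⁻ ξ, eW (α * a) ξ * ‖𝓕 (mW ((1 - α) * b / 2) f) ξ‖ₑ ^ 2 ≤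
        C * ((∫⁻ x, eW b x * ‖f x‖ₑ ^ 2) ^ (1 - α) * (∫⁻ ξ, eW a ξ * ‖𝓕 f ξ‖ₑ ^ 2) ^ α) := by
  have h1' : 0 ≤ 1 - α := by linarith
  obtain ⟨φ, hφ⟩ := exists_schwartz_ne (V := V)
  set e := (1 - α) * b / 2 with he
  have he0 : 0 ≤ e := by positivity
  set s := α * a with hs
  have hs0 : 0 ≤ s := by positivity
  obtain ⟨U, hU, hUb⟩ := unif_bound φ he0 (s / 2)
  set ψ := pr φ φ with hψ
  set K := ∫⁻ ξ, eW (-s) ξ * ‖𝓕 ψ ξ‖ₑ ^ 2 with hK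
  have hK0 : K ≠ 0 := lintegral_fourier_ne_zero ψ (by rw [hψ, pr_apply]; exact mul_ne_zero hφ hφ) _
  have hKt : K ≠ ⊤ := lintegral_weight_sq_ne_top _ _
  set T := ENNReal.ofReal (2 ^ s) with hT
  have hTt : T ≠ ⊤ := ENNReal.ofReal_ne_top
  set A := ENNReal.ofReal (2 ^ b) * ∫⁻ x, eW b x * ‖φ x‖ₑ ^ 2 with hA
  have hAt : A ≠ ⊤ := ENNReal.mul_ne_top ENNReal.ofReal_ne_top (lintegral_weight_sq_ne_top _ _)
  set B := ENNReal.ofReal (2 ^ a) * ∫⁻ x, eW a x * ‖𝓕 φ x‖ₑ ^ 2 with hB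
  have hBt : B ≠ ⊤ := ENNReal.mul_ne_top ENNReal.ofReal_ne_top (lintegral_weight_sq_ne_top _ _)
  refine ⟨K⁻¹ * (T * (T * U ^ 2 * (A ^ (1 - α) * B ^ α))), ?_, fun f => ?_⟩
  · exact ENNReal.mul_ne_top (ENNReal.inv_ne_top.2 hK0) (ENNReal.mul_ne_top hTt
      (ENNReal.mul_ne_top (ENNReal.mul_ne_top hTt (ENNReal.pow_ne_top hU)) (ENNReal.mul_ne_top
        (ENNReal.rpow_ne_top_of_nonneg h1' hAt) (ENNReal.rpow_ne_top_of_nonneg h0.le hBt))))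
  have hlow := stft_lower (mW e f) ψ hs0
  have hsw := stft_swap (mW e f) ψ s 0
  simp_rw [eW_zero, one_mul] at hsw
  rw [hsw] at hlow
  have hmid : ∀ y, ∫⁻ ξ, eW s ξ * ‖𝓕 (pr (mW e f) (tr y ψ)) ξ‖ₑ ^ 2 ≤
      T * U ^ 2 * ∫⁻ ξ, eW s ξ * (eW ((1 - α) * b) y * ‖𝓕 (pr f (tr y φ)) ξ‖ₑ ^ 2) := by
    intro y
    have hfac : pr (mW e f) (tr y ψ) = pr (mW e (tr y φ)) (pr f (tr y φ)) := by
      ext x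
      simp only [pr_apply, mW_apply, tr_apply, hψ]; ring
    rw [hfac]
    refine (mult_bound _ _ hs0).trans ?_
    have h2 : (∫⁻ ξ, eW (s / 2) ξ * ‖𝓕 (mW e (tr y φ)) ξ‖ₑ) ^ 2 ≤
        U ^ 2 * eW ((1 - α) * b) y := by
      calc _ ≤ (U * eW e y) ^ 2 := pow_le_pow_left₀ (by simp) (hUb y) 2
        _ = _ := by rw [mul_pow, eW_sq]; congr 2; rw [he]; ring
    have h3 : ∫⁻ ξ, eW s ξ * (eW ((1 - α) * b) y * ‖𝓕 (pr f (tr y φ)) ξ‖ₑ ^ 2) =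
        eW ((1 - α) * b) y * ∫⁻ ξ, eW s ξ * ‖𝓕 (pr f (tr y φ)) ξ‖ₑ ^ 2 := by
      rw [← lintegral_const_mul' _ _ (eW_ne_top _ _)]
      congr 1; funext ξ; ring
    rw [h3]
    refine (mul_le_mul_left (mul_le_mul_right h2 T) _).trans (le_of_eq ?_)
    ring
  have hTU : T * U ^ 2 ≠ ⊤ := ENNReal.mul_ne_top hTt (ENNReal.pow_ne_top hU)
  have hhi := (lintegral_mono (μ := volume) hmid).trans_eq (lintegral_const_mul' _ _ hTU)
  have hhol := stft_holder f φ (a := a) (b := b) h0 h1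
  have hAA := ENNReal.rpow_le_rpow (stft_space f φ hb.le) h1'
  have hBB := ENNReal.rpow_le_rpow (stft_upper f φ ha.le) h0.le
  rw [ENNReal.mul_rpow_of_nonneg _ _ h1'] at hAA
  rw [ENNReal.mul_rpow_of_nonneg _ _ h0.le] at hBB
  have htot := hlow.trans (mul_le_mul_right (hhi.trans (mul_le_mul_right
    (hhol.trans (mul_le_mul' hAA hBB)) _)) _)
  calc _ = K⁻¹ * (K * ∫⁻ ξ, eW s ξ * ‖𝓕 (mW e f) ξ‖ₑ ^ 2) := by
        rw [← mul_assoc, ENNReal.inv_mul_cancel hK0 hKt, one_mul]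
    _ ≤ _ := mul_le_mul_right htot _
    _ = _ := by ring


/-- The Euclidean plane. -/
abbrev E2 := WithLp 2 (ℝ × ℝ)

lemma integral_E2 {F : Type*} [NormedAddCommGroup F] [NormedSpace ℝ F] (h : E2 → F) :
    ∫ p : ℝ × ℝ, h (WithLp.toLp 2 p) = ∫ x : E2, h x :=
  (WithLp.volume_preserving_toLp ℝ ℝ).integral_comp
    (MeasurableEquiv.toLp 2 (ℝ × ℝ)).measurableEmbedding h

lemma inner_E2 (p q : ℝ × ℝ) :
    inner ℝ (WithLp.toLp 2 p : E2) (WithLp.toLp 2 q) = p.1 * q.1 + p.2 * q.2 := by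
  rw [WithLp.prod_inner_apply]
  simp [mul_comm]

lemma norm_sq_E2 (p : ℝ × ℝ) : ‖(WithLp.toLp 2 p : E2)‖ ^ 2 = p.1 ^ 2 + p.2 ^ 2 := by
  rw [WithLp.prod_norm_sq_eq_of_L2]; simp

lemma finrank_E2 : Module.finrank ℝ E2 = 2 := by
  rw [(WithLp.linearEquiv 2 ℝ (ℝ × ℝ)).finrank_eq]; simp

lemma FT2_eq (g : ℝ × ℝ → ℂ) (G : 𝓢(E2, ℂ)) (hg : ∀ p, g p = G (WithLp.toLp 2 p)) (q : ℝ × ℝ) :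
    FT2 g q = 𝓕 G ((2 * Real.pi)⁻¹ • (WithLp.toLp 2 q : E2)) := by
  rw [fourier_coe, Real.fourier_eq', ← integral_E2]
  unfold FT2
  congr 1; funext p
  rw [hg, inner_smul_right, inner_E2, smul_eq_mul]
  congr 2
  have : (Real.pi : ℂ) ≠ 0 := by exact_mod_cast Real.pi_ne_zero
  push_cast
  field_simp

lemma tg_dil (s : ℝ) : (fun x : E2 => ((wW ((2 * Real.pi) • x) ^ s : ℝ) : ℂ)).HasTemperateGrowth := by
  have h := (tg_wW (V := E2) s).comp
    (((2 * Real.pi) • ContinuousLinearMap.id ℝ E2).hasTemperateGrowth)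
  exact h

/-- The symbol applied to the Fourier transform. -/
noncomputable def symb (s : ℝ) (G : 𝓢(E2, ℂ)) : 𝓢(E2, ℂ) :=
  smulLeftCLM ℂ (fun x : E2 => ((wW ((2 * Real.pi) • x) ^ (s / 2) : ℝ) : ℂ)) (𝓕 G)

lemma symb_apply (s : ℝ) (G : 𝓢(E2, ℂ)) (x : E2) :
    symb s G x = ((wW ((2 * Real.pi) • x) ^ (s / 2) : ℝ) : ℂ) * 𝓕 G x := by
  unfold symb
  rw [smulLeftCLM_apply_apply (tg_dil _)]; rfl

lemma Jop_eq (s : ℝ) (g : ℝ × ℝ → ℂ) (G : 𝓢(E2, ℂ)) (hg : ∀ p, g p = G (WithLp.toLp 2 p))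
    (p : ℝ × ℝ) : Jop s g p = 𝓕⁻ (symb s G) (WithLp.toLp 2 p) := by
  have hpi : (Real.pi : ℂ) ≠ 0 := by exact_mod_cast Real.pi_ne_zero
  have hpi2 : (2 * Real.pi) ≠ 0 := by positivity
  rw [fourierInv_coe, Real.fourierInv_eq']
  have h := Measure.integral_comp_inv_smul (volume : Measure E2) (fun v : E2 =>
    Complex.exp (((2 * Real.pi * inner ℝ v (WithLp.toLp 2 p : E2) : ℝ) : ℂ) * Complex.I) •
      symb s G v) (2 * Real.pi)
  rw [finrank_E2, ← integral_E2] at h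
  have h2 : ∀ q : ℝ × ℝ, Complex.exp (Complex.I * ((p.1 : ℂ) * (q.1 : ℂ) + (p.2 : ℂ) * (q.2 : ℂ))) *
      (((1 + q.1 ^ 2 + q.2 ^ 2) ^ (s / 2) : ℝ) : ℂ) * FT2 g q =
      Complex.exp (((2 * Real.pi * inner ℝ ((2 * Real.pi)⁻¹ • (WithLp.toLp 2 q : E2))
        (WithLp.toLp 2 p : E2) : ℝ) : ℂ) * Complex.I) •
      symb s G ((2 * Real.pi)⁻¹ • (WithLp.toLp 2 q : E2)) := by
    intro q
    rw [FT2_eq g G hg, symb_apply, smul_smul, mul_inv_cancel₀ hpi2, one_smul, wW, norm_sq_E2,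
      smul_eq_mul, real_inner_smul_left, inner_E2, ← add_assoc, mul_assoc]
    congr 2
    push_cast
    field_simp
  unfold Jop
  simp_rw [h2]
  rw [h, abs_of_pos (by positivity), Complex.real_smul, ← mul_assoc, ← Complex.ofReal_mul,
    one_div, inv_mul_cancel₀ (by positivity), Complex.ofReal_one, one_mul]

lemma ofReal_L2_sq (g : ℝ × ℝ → ℂ) (G : 𝓢(E2, ℂ)) (hg : ∀ p, g p = G (WithLp.toLp 2 p)) :
    ENNReal.ofReal (L2norm2 g ^ 2) = ∫⁻ x, ‖G x‖ₑ ^ 2 := by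
  rw [lintegral_sq_eq, ← integral_E2]
  congr 1
  unfold L2norm2
  simp_rw [hg]
  rw [← Real.rpow_natCast, ← Real.rpow_mul (integral_nonneg fun p => by positivity)]
  norm_num

lemma ofReal_Jop_sq (s : ℝ) (g : ℝ × ℝ → ℂ) (G : 𝓢(E2, ℂ)) (hg : ∀ p, g p = G (WithLp.toLp 2 p)) :
    ENNReal.ofReal (L2norm2 (Jop s g) ^ 2) =
      ∫⁻ ξ, eW s ((2 * Real.pi) • ξ) * ‖𝓕 G ξ‖ₑ ^ 2 := by
  rw [ofReal_L2_sq _ (𝓕⁻ (symb s G)) (Jop_eq s g G hg), plancherel_inv]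
  congr 1; funext ξ
  rw [symb_apply, enorm_mul, enorm_wW, mul_pow, eW_sq]
  congr 2; ring

lemma wW_dil_lower (x : E2) : wW x ≤ wW ((2 * Real.pi) • x) := by
  unfold wW
  rw [norm_smul, mul_pow, Real.norm_of_nonneg (by positivity)]
  have : 1 ≤ (2 * Real.pi) ^ 2 := by nlinarith [Real.pi_gt_three]
  nlinarith [sq_nonneg ‖x‖]

lemma wW_dil_upper (x : E2) : wW ((2 * Real.pi) • x) ≤ (2 * Real.pi) ^ 2 * wW x := by
  unfold wW
  rw [norm_smul, mul_pow, Real.norm_of_nonneg (by positivity)]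
  have : 1 ≤ (2 * Real.pi) ^ 2 := by nlinarith [Real.pi_gt_three]
  nlinarith [sq_nonneg ‖x‖]

lemma eW_dil_lower {s : ℝ} (hs : 0 ≤ s) (x : E2) : eW s x ≤ eW s ((2 * Real.pi) • x) :=
  ENNReal.ofReal_le_ofReal (Real.rpow_le_rpow (wW_pos x).le (wW_dil_lower x) hs)

lemma eW_dil_upper {s : ℝ} (hs : 0 ≤ s) (x : E2) :
    eW s ((2 * Real.pi) • x) ≤ ENNReal.ofReal (((2 * Real.pi) ^ 2) ^ s) * eW s x := by
  unfold eW
  rw [← ENNReal.ofReal_mul (by positivity), ← Real.mul_rpow (by positivity) (wW_pos x).le]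
  exact ENNReal.ofReal_le_ofReal (Real.rpow_le_rpow (wW_pos _).le (wW_dil_upper x) hs)

lemma L2norm2_nonneg (g : ℝ × ℝ → ℂ) : 0 ≤ L2norm2 g :=
  Real.rpow_nonneg (integral_nonneg fun p => by positivity) _

lemma jbr_eq (c : ℝ) (p : ℝ × ℝ) : jbr c p = wW (WithLp.toLp 2 p : E2) ^ (c / 2) := by
  rw [jbr, wW, norm_sq_E2, add_assoc]

lemma transfer (a b α : ℝ) (ha : 0 < a) (hb : 0 < b) (h0 : 0 < α) (h1 : α < 1) :
    ∃ c : ℝ, 0 < c ∧ ∀ f : 𝓢(ℝ × ℝ, ℂ),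
      L2norm2 (Jop (α * a) (fun p => (jbr ((1 - α) * b) p : ℂ) * f p))
        ≤ c * (L2norm2 (fun p => (jbr b p : ℂ) * f p)) ^ (1 - α) *
            (L2norm2 (Jop a (⇑f))) ^ α := by
  have h1' : 0 ≤ 1 - α := by linarith
  have hs : 0 ≤ α * a := by positivity
  obtain ⟨C, hC, hmain⟩ := main_estimate (V := E2) ha hb h0 h1
  set D := ENNReal.ofReal (((2 * Real.pi) ^ 2) ^ (α * a)) * C with hD
  have hDt : D ≠ ⊤ := ENNReal.mul_ne_top ENNReal.ofReal_ne_top hC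
  refine ⟨Real.sqrt D.toReal + 1, by positivity, fun f => ?_⟩
  let G : 𝓢(E2, ℂ) :=
    compCLMOfContinuousLinearEquiv ℂ (WithLp.prodContinuousLinearEquiv 2 ℝ ℝ ℝ) f
  have hG : ∀ p, f p = G (WithLp.toLp 2 p) := fun p => rfl
  have hGc : ∀ (c : ℝ) p, (jbr c p : ℂ) * f p = mW (c / 2) G (WithLp.toLp 2 p) := by
    intro c p
    rw [mW_apply, jbr_eq, hG]
  have eX := ofReal_Jop_sq (α * a) _ _ (hGc ((1 - α) * b))
  have eY := ofReal_L2_sq _ _ (hGc b)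
  have eZ := ofReal_Jop_sq a _ _ hG
  have nX := L2norm2_nonneg (Jop (α * a) (fun p => (jbr ((1 - α) * b) p : ℂ) * f p))
  have nY := L2norm2_nonneg (fun p => (jbr b p : ℂ) * f p)
  have nZ := L2norm2_nonneg (Jop a (⇑f))
  generalize L2norm2 (Jop (α * a) (fun p => (jbr ((1 - α) * b) p : ℂ) * f p)) = X at *
  generalize L2norm2 (fun p => (jbr b p : ℂ) * f p) = Y at *
  generalize L2norm2 (Jop a (⇑f)) = Z at *
  rw [← lintegral_weight_sq] at eY
  have hm := hmain G
  rw [← eY] at hm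
  have hZ : ∫⁻ ξ, eW a ξ * ‖𝓕 G ξ‖ₑ ^ 2 ≤ ENNReal.ofReal (Z ^ 2) := by
    rw [eZ]
    exact lintegral_mono fun ξ => mul_le_mul_left (eW_dil_lower ha.le ξ) _
  have hX : ENNReal.ofReal (X ^ 2) ≤ ENNReal.ofReal (((2 * Real.pi) ^ 2) ^ (α * a)) *
      ∫⁻ ξ, eW (α * a) ξ * ‖𝓕 (mW ((1 - α) * b / 2) G) ξ‖ₑ ^ 2 := by
    rw [eX, ← lintegral_const_mul' _ _ ENNReal.ofReal_ne_top]
    refine lintegral_mono fun ξ => ?_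
    refine (mul_le_mul_left (eW_dil_upper hs ξ) _).trans (le_of_eq ?_)
    ring
  have hall : ENNReal.ofReal (X ^ 2) ≤
      D * (ENNReal.ofReal (Y ^ 2) ^ (1 - α) * ENNReal.ofReal (Z ^ 2) ^ α) := by
    refine hX.trans ?_
    rw [hD, mul_assoc]
    refine mul_le_mul_right (hm.trans (mul_le_mul_right (mul_le_mul_right ?_ _) _)) _
    exact ENNReal.rpow_le_rpow hZ h0.le
  rw [ENNReal.ofReal_rpow_of_nonneg (by positivity) h1',
    ENNReal.ofReal_rpow_of_nonneg (by positivity) h0.le, ← ENNReal.ofReal_toReal hDt,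
    ← ENNReal.ofReal_mul (by positivity), ← ENNReal.ofReal_mul (by positivity),
    ENNReal.ofReal_le_ofReal_iff (by positivity)] at hall
  have hY2 : (Y ^ 2) ^ (1 - α) = (Y ^ (1 - α)) ^ 2 := by
    rw [← Real.rpow_natCast, ← Real.rpow_natCast, ← Real.rpow_mul nY, ← Real.rpow_mul nY, mul_comm]
  have hZ2 : (Z ^ 2) ^ α = (Z ^ α) ^ 2 := by
    rw [← Real.rpow_natCast, ← Real.rpow_natCast, ← Real.rpow_mul nZ, ← Real.rpow_mul nZ, mul_comm]
  rw [hY2, hZ2] at hall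
  have hfin : X ≤ Real.sqrt D.toReal * Y ^ (1 - α) * Z ^ α := by
    refine le_of_sq_le_sq ?_ (by positivity)
    rw [mul_pow, mul_pow, Real.sq_sqrt (by positivity), mul_assoc]
    exact hall
  refine hfin.trans ?_
  gcongr
  linarith

end Main

/-- Interpolation estimate: for `a, b > 0` and `α ∈ (0,1)` there is `c > 0` with
`‖J^{αa}(⟨x,y⟩^{(1−α)b} f)‖ ≤ c ‖⟨x,y⟩^b f‖^{1−α} ‖J^a f‖^α` for all Schwartz `f`. -/
theorem Jop_jbr_interpolation (a b α : ℝ) (ha : 0 < a) (hb : 0 < b)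
    (hα : α ∈ Set.Ioo (0 : ℝ) 1) :
    ∃ c : ℝ, 0 < c ∧ ∀ f : SchwartzMap (ℝ × ℝ) ℂ,
      L2norm2 (Jop (α * a) (fun p => (jbr ((1 - α) * b) p : ℂ) * f p))
        ≤ c * (L2norm2 (fun p => (jbr b p : ℂ) * f p)) ^ (1 - α) *
            (L2norm2 (Jop a (⇑f))) ^ α := by
  exact transfer a b α ha hb hα.1 hα.2
end

section
/- There exists a constant c > 0 such that for all Schwartz functions φ, f : ℝ → ℂ, ‖D^{1/2}(φ f) − φ · D^{1/2} f‖_{L²(ℝ)} ≤ c ‖φ‖_{H²(ℝ)} ‖f‖_{L²(ℝ)}. -/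
open MeasureTheory

/-- The Fourier transform on `ℝ`: `ĝ(ξ) = ∫ e^{−ixξ} g(x) dx`. -/
noncomputable def FT1 (f : ℝ → ℂ) (ξ : ℝ) : ℂ :=
  ∫ x : ℝ, Complex.exp (-(Complex.I * (x : ℂ) * (ξ : ℂ))) * f x

/-- The fractional derivative `D^{1/2}` on `ℝ`, defined via the Fourier transform by
`(D^{1/2} g)^(ξ) = |ξ|^{1/2} ĝ(ξ)`; here realized by Fourier inversion. -/
noncomputable def Dhalf (f : ℝ → ℂ) (x : ℝ) : ℂ :=
  ((1 / (2 * Real.pi) : ℝ) : ℂ) *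
    ∫ ξ : ℝ, Complex.exp (Complex.I * (x : ℂ) * (ξ : ℂ)) *
      ((|ξ| ^ ((1 : ℝ) / 2) : ℝ) : ℂ) * FT1 f ξ

open FourierTransform

/-- `L¹ ∩ L²` Plancherel. -/
lemma planch {G : ℝ → ℂ} (h1 : Integrable G) (h2 : MemLp G 2 volume) :
    ∫⁻ x, ‖𝓕 G x‖ₑ ^ 2 = ∫⁻ x, ‖G x‖ₑ ^ 2 := by
  have key : ((𝓕 (h2.toLp G) : Lp ℂ 2 (volume : Measure ℝ)) : ℝ → ℂ) =ᵐ[volume] 𝓕 G := by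
    have hcont : Continuous (𝓕 G) :=
      VectorFourier.fourierIntegral_continuous Real.continuous_fourierChar
        (L := innerₗ ℝ) continuous_inner h1
    apply ae_eq_of_integral_contDiff_smul_eq
    · exact (Lp.memLp (𝓕 (h2.toLp G) : Lp ℂ 2 (volume : Measure ℝ))).locallyIntegrable (by norm_num)
    · exact hcont.locallyIntegrable
    · intro g hg hc
      have hc' : HasCompactSupport (fun x => (g x : ℂ)) := hc.comp_left (g := Complex.ofReal) rfl
      let ψ : SchwartzMap ℝ ℂ := hc'.toSchwartzMap (Complex.ofRealCLM.contDiff.comp hg)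
      have hψ : ∀ x, ψ x = (g x : ℂ) := fun x => rfl
      have e := DFunLike.congr_fun (Lp.fourier_toTemperedDistribution_eq (h2.toLp G)) ψ
      rw [TemperedDistribution.fourier_apply, Lp.toTemperedDistribution_apply,
        Lp.toTemperedDistribution_apply] at e
      have e2 : ∫ x, (𝓕 ψ) x • (h2.toLp G) x = ∫ x, (𝓕 ψ) x • G x := by
        apply integral_congr_ae
        filter_upwards [h2.coeFn_toLp] with x hx
        rw [hx]
      have e3 : ∫ x, (𝓕 (ψ : ℝ → ℂ)) x • G x = ∫ x, ψ x • 𝓕 G x := by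
        have := VectorFourier.integral_fourierIntegral_smul_eq_flip (L := innerₗ ℝ)
          (μ := volume) (ν := volume) Real.continuous_fourierChar continuous_inner ψ.integrable h1
        rw [flip_innerₗ] at this
        exact this
      rw [e2, SchwartzMap.fourier_coe, e3] at e
      simpa [hψ] using e.symm
  have n := Lp.norm_fourier_eq (h2.toLp G)
  rw [Lp.norm_def, Lp.norm_def, ENNReal.toReal_eq_toReal_iff' (Lp.eLpNorm_ne_top _) (Lp.eLpNorm_ne_top _),
    eLpNorm_congr_ae key, eLpNorm_congr_ae h2.coeFn_toLp] at n
  have two : ∀ f : ℝ → ℂ, eLpNorm f 2 volume ^ 2 = ∫⁻ x, ‖f x‖ₑ ^ 2 := by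
    intro f
    have := eLpNorm_nnreal_pow_eq_lintegral (f := f) (μ := volume) (p := 2) (by norm_num)
    simpa using this
  rw [← two, ← two, n]

/-- The weight. -/
noncomputable def wt (u : ℝ) : ℝ := |2 * Real.pi * u| ^ ((1 : ℝ) / 2)

lemma wt_sub (u v : ℝ) : |wt u - wt v| ≤ wt (u - v) := by
  have h : ∀ a b : ℝ, wt a ≤ wt b + wt (a - b) := by
    intro a b
    unfold wt
    simp only [← Real.sqrt_eq_rpow]
    have sq_add : ∀ p q : ℝ, 0 ≤ p → 0 ≤ q → √(p + q) ≤ √p + √q := by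
      intro p q hp hq
      rw [Real.sqrt_le_left (by positivity)]
      nlinarith [Real.sq_sqrt hp, Real.sq_sqrt hq, Real.sqrt_nonneg p, Real.sqrt_nonneg q,
        mul_nonneg (Real.sqrt_nonneg p) (Real.sqrt_nonneg q)]
    refine le_trans (Real.sqrt_le_sqrt ?_) (sq_add _ _ (abs_nonneg _) (abs_nonneg _))
    refine le_trans (le_of_eq ?_) (abs_add_le _ _)
    ring_nf
  have hs : wt (v - u) = wt (u - v) := by
    unfold wt
    rw [← abs_neg]; ring_nf
  rw [abs_le]
  constructor
  · have := h v u; linarith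
  · have := h u v; linarith

lemma wt_nonneg (u : ℝ) : 0 ≤ wt u := by unfold wt; positivity

lemma wt_sq (u : ℝ) : wt u ^ 2 = 2 * Real.pi * |u| := by
  unfold wt
  rw [← Real.sqrt_eq_rpow, Real.sq_sqrt (abs_nonneg _), abs_mul, abs_of_pos (by positivity)]

lemma wt_cont : Continuous wt := by
  unfold wt
  exact Continuous.rpow_const (by fun_prop) (fun x => Or.inr (by norm_num))

lemma FT1_eq (f : ℝ → ℂ) (u : ℝ) : FT1 f (2 * Real.pi * u) = 𝓕 f u := by
  rw [Real.fourier_real_eq_integral_exp_smul]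
  unfold FT1
  congr 1
  ext x
  rw [smul_eq_mul]
  congr 2
  push_cast
  ring

lemma Dhalf_eq (f : ℝ → ℂ) (x : ℝ) : Dhalf f x = 𝓕⁻ (fun u => (wt u : ℂ) * 𝓕 f u) x := by
  rw [Real.fourierInv_eq']
  unfold Dhalf
  have := Measure.integral_comp_mul_left (fun ξ : ℝ => Complex.exp (Complex.I * (x : ℂ) * (ξ : ℂ)) *
      ((|ξ| ^ ((1 : ℝ) / 2) : ℝ) : ℂ) * FT1 f ξ) (2 * Real.pi)
  rw [abs_of_pos (by positivity), Complex.real_smul] at this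
  rw [one_div (2 * Real.pi), ← this]
  congr 1
  ext u
  rw [FT1_eq, smul_eq_mul, mul_assoc]
  congr 2
  push_cast
  simp only [RCLike.inner_apply, conj_trivial]
  push_cast
  ring

lemma wt_mul_int (k : SchwartzMap ℝ ℂ) : Integrable (fun u => (wt u : ℂ) * k u) := by
  have h1 : Integrable (fun u => ‖u‖ ^ 1 * ‖k u‖) := k.integrable_pow_mul volume 1
  have h2 := (k.integrable.norm.const_mul 1).add (h1.const_mul (2 * Real.pi))
  refine h2.mono' ?_ ?_
  · exact ((Complex.continuous_ofReal.comp wt_cont).mul k.continuous).aestronglyMeasurable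
  · refine Filter.Eventually.of_forall fun u => ?_
    simp only [Pi.add_apply, norm_mul, Complex.norm_real, Real.norm_eq_abs, abs_of_nonneg (wt_nonneg u), pow_one]
    have : wt u ≤ 1 + 2 * Real.pi * |u| := by
      have := wt_sq u
      nlinarith [wt_nonneg u, sq_nonneg (wt u - 1)]
    nlinarith [norm_nonneg (k u)]

open scoped Convolution

lemma conv_eq (φ f : SchwartzMap ℝ ℂ) (u : ℝ) :
    𝓕 (fun y => φ y * f y) u
      = ((𝓕 φ : SchwartzMap ℝ ℂ) ⋆[ContinuousLinearMap.mul ℂ ℂ] (𝓕 f : SchwartzMap ℝ ℂ)) u := by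
  set S := SchwartzMap.convolution (ContinuousLinearMap.mul ℂ ℂ) (𝓕 φ) (𝓕 f) with hS
  rw [← SchwartzMap.convolution_apply, ← hS]
  have : (fun y => φ y * f y) = (𝓕⁻ S : SchwartzMap ℝ ℂ) := by
    ext y
    rw [SchwartzMap.fourierInv_coe, Real.fourierInv_eq_fourier_neg, ← SchwartzMap.fourier_coe, hS,
      SchwartzMap.fourier_convolution, SchwartzMap.pairing_apply_apply, SchwartzMap.fourier_coe,
      SchwartzMap.fourier_coe (𝓕 f),
      ← Real.fourierInv_eq_fourier_neg, ← Real.fourierInv_eq_fourier_neg, ← SchwartzMap.fourierInv_coe,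
      ← SchwartzMap.fourierInv_coe]
    simp
  rw [this, ← SchwartzMap.fourier_coe]
  simp

/-- Fourier side of the commutator. -/
noncomputable def FF (h k : SchwartzMap ℝ ℂ) (ξ : ℝ) : ℂ :=
  (wt ξ : ℂ) * (h ⋆[ContinuousLinearMap.mul ℂ ℂ] k) ξ
    - (h ⋆[ContinuousLinearMap.mul ℂ ℂ] (fun u => (wt u : ℂ) * k u)) ξ

lemma FF_int (h k : SchwartzMap ℝ ℂ) : Integrable (FF h k) := by
  refine Integrable.sub ?_ ?_
  · have := wt_mul_int (SchwartzMap.convolution (ContinuousLinearMap.mul ℂ ℂ) h k)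
    simpa only [SchwartzMap.convolution_apply] using this
  · exact h.integrable.integrable_convolution _ (wt_mul_int k)

lemma comm_eq (φ f : SchwartzMap ℝ ℂ) (x : ℝ) :
    Dhalf (fun y => φ y * f y) x - φ x * Dhalf (⇑f) x = 𝓕 (FF (𝓕 φ) (𝓕 f)) (-x) := by
  have i1 : Integrable (fun ξ => (wt ξ : ℂ) *
      ((𝓕 φ : SchwartzMap ℝ ℂ) ⋆[ContinuousLinearMap.mul ℂ ℂ] (𝓕 f : SchwartzMap ℝ ℂ)) ξ) := by
    have := wt_mul_int (SchwartzMap.convolution (ContinuousLinearMap.mul ℂ ℂ) (𝓕 φ) (𝓕 f))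
    simpa only [SchwartzMap.convolution_apply] using this
  have i2 := (𝓕 φ : SchwartzMap ℝ ℂ).integrable.integrable_convolution (μ := volume)
    (ContinuousLinearMap.mul ℂ ℂ) (wt_mul_int (𝓕 f))
  have hφ : φ x = 𝓕 ((𝓕 φ : SchwartzMap ℝ ℂ) : ℝ → ℂ) (-x) := by
    rw [← Real.fourierInv_eq_fourier_neg, ← SchwartzMap.fourierInv_coe]; simp
  rw [Dhalf_eq, Dhalf_eq, Real.fourierInv_eq_fourier_neg, Real.fourierInv_eq_fourier_neg]
  simp only [conv_eq]
  rw [hφ, ← SchwartzMap.fourier_coe f, ← Real.fourier_mul_convolution_eq (𝓕 φ : SchwartzMap ℝ ℂ).integrable (wt_mul_int (𝓕 f))]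
  unfold FF
  rw [Real.fourier_eq, Real.fourier_eq, Real.fourier_eq, ← integral_sub]
  · simp only [smul_sub]
  · exact (Real.fourierIntegral_convergent_iff _).2 i1
  · exact (Real.fourierIntegral_convergent_iff _).2 i2

lemma FF_bound (h k : SchwartzMap ℝ ℂ) (ξ : ℝ) :
    ‖FF h k ξ‖ₑ ≤ ∫⁻ η, ‖h η‖ₑ * (‖wt η‖ₑ * ‖k (ξ - η)‖ₑ) := by
  obtain ⟨C, hC⟩ : ∃ C, ∀ x, ‖h x‖ ≤ C := ⟨_, fun x => SchwartzMap.norm_le_seminorm ℝ h x⟩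
  have j1 : Integrable (fun η => h η * k (ξ - η)) :=
    (k.integrable.comp_sub_left ξ).bdd_mul h.continuous.aestronglyMeasurable (.of_forall hC)
  have j2 : Integrable (fun η => h η * ((wt (ξ - η) : ℂ) * k (ξ - η))) :=
    ((wt_mul_int k).comp_sub_left ξ).bdd_mul h.continuous.aestronglyMeasurable (.of_forall hC)
  have : FF h k ξ = ∫ η, h η * (((wt ξ : ℂ) - wt (ξ - η)) * k (ξ - η)) := by
    unfold FF
    simp only [convolution_def, ContinuousLinearMap.mul_apply']
    rw [← integral_const_mul, ← integral_sub (j1.const_mul _) j2]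
    congr 1; ext η; ring
  rw [this]
  refine (enorm_integral_le_lintegral_enorm _).trans (lintegral_mono fun η => ?_)
  simp only [enorm_mul]
  gcongr
  rw [← Complex.ofReal_sub, enorm_le_iff_norm_le, Complex.norm_real, Real.norm_eq_abs, Real.norm_eq_abs,
    abs_of_nonneg (wt_nonneg η)]
  simpa using wt_sub ξ (ξ - η)

lemma FF_L2 (h k : SchwartzMap ℝ ℂ) :
    ∫⁻ ξ, ‖FF h k ξ‖ₑ ^ 2 ≤ ENNReal.ofReal (2 * Real.pi ^ 2) *
      (∫⁻ η, ‖((1 + η ^ 2 : ℝ) : ℂ) * h η‖ₑ ^ 2) * ∫⁻ η, ‖k η‖ₑ ^ 2 := by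
  set N := ∫⁻ η, ‖((1 + η ^ 2 : ℝ) : ℂ) * h η‖ₑ ^ 2 with hN
  let a : ℝ → ENNReal := fun η => ‖wt η * (1 + η ^ 2)⁻¹‖ₑ
  have ha : Measurable a := by
    have := wt_cont.measurable
    fun_prop
  have hk : Measurable fun x => ‖k x‖ₑ := k.continuous.measurable.enorm
  have hkm : Measurable (k : ℝ → ℂ) := k.continuous.measurable
  have hk2 : Measurable fun p : ℝ × ℝ => a p.2 ^ 2 * ‖k (p.1 - p.2)‖ₑ ^ 2 :=
    ((ha.comp measurable_snd).pow_const 2).mul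
      ((hk.comp (measurable_fst.sub measurable_snd)).pow_const 2)
  have hh : Measurable fun η : ℝ => ‖((1 + η ^ 2 : ℝ) : ℂ) * h η‖ₑ := by
    have := h.continuous.measurable
    fun_prop
  have pt : ∀ ξ, ‖FF h k ξ‖ₑ ^ 2 ≤ N * ∫⁻ η, a η ^ 2 * ‖k (ξ - η)‖ₑ ^ 2 := by
    intro ξ
    have e1 : ∫⁻ η, ‖h η‖ₑ * (‖wt η‖ₑ * ‖k (ξ - η)‖ₑ)
        = ∫⁻ η, ((fun η : ℝ => ‖((1 + η ^ 2 : ℝ) : ℂ) * h η‖ₑ) * (fun η => a η * ‖k (ξ - η)‖ₑ)) η := by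
      congr 1; ext η
      simp only [Pi.mul_apply, a, enorm_mul]
      have : ‖((1 + η ^ 2 : ℝ) : ℂ)‖ₑ * ‖((1 + η ^ 2)⁻¹ : ℝ)‖ₑ = 1 := by
        have : ‖((1 + η ^ 2 : ℝ) : ℂ)‖ₑ = ‖(1 + η ^ 2 : ℝ)‖ₑ := by
          rw [← ofReal_norm, ← ofReal_norm, Complex.norm_real]
        rw [this, ← enorm_mul, mul_inv_cancel₀ (by positivity)]
        simp
      calc _ = (‖((1 + η ^ 2 : ℝ) : ℂ)‖ₑ * ‖((1 + η ^ 2)⁻¹ : ℝ)‖ₑ) * (‖h η‖ₑ * (‖wt η‖ₑ * ‖k (ξ - η)‖ₑ)) := by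
            rw [this, one_mul]
        _ = _ := by ring
    have e2 := ENNReal.lintegral_mul_le_Lp_mul_Lq volume Real.HolderConjugate.two_two hh.aemeasurable
      (g := fun η => a η * ‖k (ξ - η)‖ₑ) (by fun_prop)
    have e3 := (FF_bound h k ξ).trans (e1.le.trans e2)
    have e4 := ENNReal.pow_le_pow_left (n := 2) e3
    refine e4.trans (le_of_eq ?_)
    have sq : ∀ z : ENNReal, (z ^ ((1:ℝ)/2)) ^ 2 = z := by
      intro z
      rw [← ENNReal.rpow_natCast, ← ENNReal.rpow_mul]; norm_num
    rw [mul_pow, sq, sq]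
    simp only [ENNReal.rpow_ofNat, mul_pow]
    rw [hN]
  have ha2 : ∫⁻ η, a η ^ 2 ≤ ENNReal.ofReal (2 * Real.pi ^ 2) := by
    have : ENNReal.ofReal (2 * Real.pi ^ 2) = ∫⁻ η : ℝ, ENNReal.ofReal (2 * Real.pi * (1 + η ^ 2)⁻¹) := by
      rw [← ofReal_integral_eq_lintegral_ofReal (integrable_inv_one_add_sq.const_mul _)
        (.of_forall fun η => by positivity), integral_const_mul, integral_univ_inv_one_add_sq]
      ring_nf
    rw [this]
    refine lintegral_mono fun η => ?_
    simp only [a]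
    rw [← ofReal_norm, ← ENNReal.ofReal_pow (norm_nonneg _)]
    apply ENNReal.ofReal_le_ofReal
    rw [Real.norm_eq_abs, sq_abs, mul_pow, wt_sq, mul_assoc]
    gcongr
    rw [pow_two, ← mul_assoc]
    have : |η| * (1 + η ^ 2)⁻¹ ≤ 1 := by
      rw [← div_eq_mul_inv, div_le_one (by positivity)]
      nlinarith [sq_abs η, sq_nonneg (|η| - 1)]
    calc _ ≤ 1 * (1 + η ^ 2)⁻¹ := by gcongr
      _ = _ := one_mul _
  calc _ ≤ ∫⁻ ξ, N * ∫⁻ η, a η ^ 2 * ‖k (ξ - η)‖ₑ ^ 2 := lintegral_mono pt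
    _ = N * ∫⁻ ξ, ∫⁻ η, a η ^ 2 * ‖k (ξ - η)‖ₑ ^ 2 := by
        rw [lintegral_const_mul]
        exact Measurable.lintegral_prod_right' (f := fun p : ℝ × ℝ => a p.2 ^ 2 * ‖k (p.1 - p.2)‖ₑ ^ 2)
          hk2
    _ = N * ∫⁻ η, ∫⁻ ξ, a η ^ 2 * ‖k (ξ - η)‖ₑ ^ 2 := by
        rw [lintegral_lintegral_swap]
        exact hk2.aemeasurable
    _ = N * ((∫⁻ η, a η ^ 2) * ∫⁻ η, ‖k η‖ₑ ^ 2) := by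
        congr 1
        rw [← lintegral_mul_const _ (by fun_prop)]
        refine lintegral_congr fun η => ?_
        rw [lintegral_const_mul _ (by fun_prop),
          lintegral_sub_right_eq_self (fun x => ‖k x‖ₑ ^ 2) η]
    _ ≤ N * (ENNReal.ofReal (2 * Real.pi ^ 2) * ∫⁻ η, ‖k η‖ₑ ^ 2) := by gcongr
    _ = _ := by ring

lemma conv_int (G : ℝ → ℂ) (hG : AEStronglyMeasurable G) :
    ∫ x, ‖G x‖ ^ 2 = (∫⁻ x, ‖G x‖ₑ ^ 2).toReal := by
  have hG2 : AEStronglyMeasurable (fun x => ‖G x‖ ^ 2) := hG.norm.pow 2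
  rw [integral_eq_lintegral_of_nonneg_ae (.of_forall fun x => by positivity) hG2]
  congr 2; ext x
  rw [ENNReal.ofReal_pow (norm_nonneg _), ofReal_norm]

lemma weighted_int (h : SchwartzMap ℝ ℂ) (c : ℝ) :
    Integrable fun η : ℝ => ‖((1 + (c * η) ^ 2 : ℝ) : ℂ) * h η‖ ^ 2 := by
  obtain ⟨C, hC⟩ : ∃ C, ∀ x, ‖h x‖ ≤ C := ⟨_, fun x => SchwartzMap.norm_le_seminorm ℝ h x⟩
  have h0 : Integrable (fun u => ‖h u‖) := h.integrable.norm
  have h2 : Integrable (fun u => ‖u‖ ^ 2 * ‖h u‖) := h.integrable_pow_mul volume 2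
  have h4 : Integrable (fun u => ‖u‖ ^ 4 * ‖h u‖) := h.integrable_pow_mul volume 4
  have H := ((h0.add (h2.const_mul (2 * c ^ 2))).add (h4.const_mul (c ^ 4))).bdd_mul
    h.continuous.norm.aestronglyMeasurable (c := C) (.of_forall fun x => by simpa using hC x)
  refine H.congr (.of_forall fun η => ?_)
  simp only [Pi.add_apply, norm_mul, Complex.norm_real, Real.norm_eq_abs, mul_pow, sq_abs]
  have : |η| ^ 4 = η ^ 4 := by rw [show 4 = 2 * 2 from rfl, pow_mul, pow_mul, sq_abs]
  rw [this]; ring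

theorem Dhalf_commutator_estimate :
    ∃ c : ℝ, 0 < c ∧ ∀ φ f : SchwartzMap ℝ ℂ,
      (∫ x : ℝ, ‖Dhalf (fun y => φ y * f y) x - φ x * Dhalf (⇑f) x‖ ^ 2) ^ ((1 : ℝ) / 2)
        ≤ c * (∫ ξ : ℝ, ‖(((1 + ξ ^ 2 : ℝ)) : ℂ) * FT1 (⇑φ) ξ‖ ^ 2) ^ ((1 : ℝ) / 2) *
            (∫ x : ℝ, ‖f x‖ ^ 2) ^ ((1 : ℝ) / 2) := by
  refine ⟨2 * Real.pi, by positivity, fun φ f => ?_⟩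
  set h : SchwartzMap ℝ ℂ := 𝓕 φ with hh
  set k : SchwartzMap ℝ ℂ := 𝓕 f with hk
  have hL := FF_L2 h k
  have hw := weighted_int h 1
  simp only [one_mul] at hw
  have mw : AEStronglyMeasurable (fun η : ℝ => ((1 + η ^ 2 : ℝ) : ℂ) * h η) := by
    have := h.continuous
    exact Continuous.aestronglyMeasurable (by fun_prop)
  have hN : ∫⁻ η, ‖((1 + η ^ 2 : ℝ) : ℂ) * h η‖ₑ ^ 2
      = ENNReal.ofReal (∫ η : ℝ, ‖((1 + η ^ 2 : ℝ) : ℂ) * h η‖ ^ 2) := by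
    rw [ofReal_integral_eq_lintegral_ofReal hw (.of_forall fun η => by positivity)]
    congr 1; ext x
    rw [ENNReal.ofReal_pow (norm_nonneg _), ofReal_norm]
  have hK : ∫⁻ η, ‖k η‖ₑ ^ 2 = ENNReal.ofReal (∫ x : ℝ, ‖f x‖ ^ 2) := by
    rw [← SchwartzMap.integral_norm_sq_fourier f, ← hk]
    have : Integrable fun x => ‖k x‖ ^ 2 := (k.memLp 2 volume).integrable_norm_pow (p := 2) (by norm_num)
    rw [ofReal_integral_eq_lintegral_ofReal this (.of_forall fun η => by positivity)]
    congr 1; ext x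
    rw [ENNReal.ofReal_pow (norm_nonneg _), ofReal_norm]
  have hFi := FF_int h k
  set A := ∫ η : ℝ, ‖((1 + η ^ 2 : ℝ) : ℂ) * h η‖ ^ 2 with hA
  set B := ∫ x : ℝ, ‖f x‖ ^ 2 with hB
  have hA0 : 0 ≤ A := integral_nonneg fun _ => by positivity
  have hB0 : 0 ≤ B := integral_nonneg fun _ => by positivity
  rw [hN, hK, ← ENNReal.ofReal_mul (by positivity), ← ENNReal.ofReal_mul (by positivity)] at hL
  have hF2 : MemLp (FF h k) 2 := by
    refine ⟨hFi.aestronglyMeasurable, ?_⟩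
    rw [eLpNorm_lt_top_iff_lintegral_rpow_enorm_lt_top (by norm_num) (by norm_num)]
    refine lt_of_le_of_lt ?_ (hL.trans_lt ENNReal.ofReal_lt_top)
    simp
  have hP := planch hFi hF2
  have hcont : Continuous (𝓕 (FF h k)) :=
      VectorFourier.fourierIntegral_continuous Real.continuous_fourierChar
        (L := innerₗ ℝ) continuous_inner hFi
  have hL' : ∫ x : ℝ, ‖Dhalf (fun y => φ y * f y) x - φ x * Dhalf (⇑f) x‖ ^ 2
      ≤ 2 * Real.pi ^ 2 * A * B := by
    simp only [comm_eq]
    rw [integral_neg_eq_self (fun x => ‖𝓕 (FF h k) x‖ ^ 2), conv_int _ hcont.aestronglyMeasurable, hP]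
    exact ENNReal.toReal_le_of_le_ofReal (by positivity) hL
  have hA' : A ≤ ∫ ξ : ℝ, ‖(((1 + ξ ^ 2 : ℝ)) : ℂ) * FT1 (⇑φ) ξ‖ ^ 2 := by
    have e := Measure.integral_comp_mul_left
      (fun ξ : ℝ => ‖(((1 + ξ ^ 2 : ℝ)) : ℂ) * FT1 (⇑φ) ξ‖ ^ 2) (2 * Real.pi)
    simp only [FT1_eq, ← SchwartzMap.fourier_coe, ← hh] at e
    have p3 := Real.pi_gt_three
    have l : A ≤ ∫ η : ℝ, ‖((1 + (2 * Real.pi * η) ^ 2 : ℝ) : ℂ) * h η‖ ^ 2 := by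
      refine integral_mono hw (weighted_int h (2 * Real.pi)) fun η => ?_
      simp only [norm_mul, Complex.norm_real, Real.norm_eq_abs]
      have : |1 + η ^ 2| ≤ |1 + (2 * Real.pi * η) ^ 2| := by
        rw [abs_of_nonneg (by positivity), abs_of_nonneg (by positivity), mul_pow]
        have : 1 ≤ (2 * Real.pi) ^ 2 := by nlinarith
        nlinarith [sq_nonneg η]
      gcongr
    rw [e, abs_of_pos (by positivity), smul_eq_mul] at l
    refine l.trans (mul_le_of_le_one_left (integral_nonneg fun _ => by positivity) ?_)
    exact inv_le_one_of_one_le₀ (by linarith)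
  set A' := ∫ ξ : ℝ, ‖(((1 + ξ ^ 2 : ℝ)) : ℂ) * FT1 (⇑φ) ξ‖ ^ 2
  have hA'0 : 0 ≤ A' := hA0.trans hA'
  simp only [← Real.sqrt_eq_rpow]
  rw [Real.sqrt_le_left (by positivity), mul_pow, mul_pow, Real.sq_sqrt hA'0, Real.sq_sqrt hB0]
  refine hL'.trans ?_
  gcongr
  nlinarith [sq_nonneg Real.pi]
end

section
/- Let s₁ > 1 and s₂ > 1. Define, for a Schwartz function f : ℝ² → ℂ, N(f) = ( ‖f̂‖_{L²(ℝ²)}² + ‖(1+ξ²)^{s₁/2} f̂‖_{L²(ℝ²)}² + ‖(1+η²)^{s₂/2} f̂‖_{L²(ℝ²)}² )^{1/2}, where f̂(ξ,η) = ∫_{ℝ²} e^{−i(xξ + yη)} f(x,y) dx dy. Then there exists a constant c (depending only on s₁, s₂) such that for all Schwartz functions u, v : ℝ² → ℂ, N(u·v) ≤ c · N(u) · N(v). -/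
open MeasureTheory

/-- The (Fourier-side) anisotropic Sobolev `H^{s₁,s₂}(ℝ²)` norm:
`N(f) = (‖f̂‖² + ‖(1+ξ²)^{s₁/2} f̂‖² + ‖(1+η²)^{s₂/2} f̂‖²)^{1/2}`. -/
noncomputable def anisoNorm (s₁ s₂ : ℝ) (f : ℝ × ℝ → ℂ) : ℝ :=
  ((∫ q : ℝ × ℝ, ‖FT2 f q‖ ^ 2)
    + (∫ q : ℝ × ℝ, ‖(((1 + q.1 ^ 2) ^ (s₁ / 2) : ℝ) : ℂ) * FT2 f q‖ ^ 2)
    + (∫ q : ℝ × ℝ, ‖(((1 + q.2 ^ 2) ^ (s₂ / 2) : ℝ) : ℂ) * FT2 f q‖ ^ 2)) ^ ((1 : ℝ) / 2)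


open scoped ENNReal

lemma aux_cs {α : Type*} [MeasurableSpace α] (μ : Measure α) (a b : α → ℝ≥0∞)
    (ha : AEMeasurable a μ) (hb : AEMeasurable b μ) :
    (∫⁻ x, a x * b x ∂μ) ^ 2 ≤ (∫⁻ x, a x ^ 2 ∂μ) * ∫⁻ x, b x ^ 2 ∂μ := by
  have h := ENNReal.lintegral_mul_le_Lp_mul_Lq μ Real.HolderConjugate.two_two ha hb
  simp only [Pi.mul_apply, ENNReal.rpow_ofNat] at h
  calc (∫⁻ x, a x * b x ∂μ) ^ 2
      ≤ ((∫⁻ x, a x ^ 2 ∂μ) ^ ((1:ℝ)/2) * (∫⁻ x, b x ^ 2 ∂μ) ^ ((1:ℝ)/2)) ^ 2 := by gcongr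
    _ = _ := by
      rw [mul_pow, ← ENNReal.rpow_natCast, ← ENNReal.rpow_natCast, ← ENNReal.rpow_mul,
        ← ENNReal.rpow_mul]
      norm_num

/-- Young inequality `L² * L¹ → L²`. -/
lemma aux_young (f g : ℝ × ℝ → ℝ≥0∞) (hf : Measurable f) (hg : Measurable g) :
    ∫⁻ q, (∫⁻ r, f (q - r) * g r) ^ 2 ≤ (∫⁻ q, f q ^ 2) * (∫⁻ r, g r) ^ 2 := by
  have hs : ∀ x : ℝ≥0∞, x ^ ((1:ℝ)/2) * x ^ ((1:ℝ)/2) = x := by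
    intro x
    rw [← ENNReal.rpow_add_of_nonneg _ _ (by norm_num) (by norm_num)]; norm_num
  have h1 : ∀ q, (∫⁻ r, f (q - r) * g r) ^ 2 ≤ (∫⁻ r, f (q - r) ^ 2 * g r) * ∫⁻ r, g r := by
    intro q
    have := aux_cs volume (fun r => f (q - r) * g r ^ ((1:ℝ)/2)) (fun r => g r ^ ((1:ℝ)/2))
      (by fun_prop) (by fun_prop)
    simpa only [mul_pow, mul_assoc, pow_two, hs, mul_left_comm, mul_comm] using this
  have hm : Measurable (Function.uncurry fun (q r : ℝ × ℝ) => f (q - r) ^ 2 * g r) := by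
    unfold Function.uncurry; fun_prop
  calc ∫⁻ q, (∫⁻ r, f (q - r) * g r) ^ 2
      ≤ ∫⁻ q, (∫⁻ r, f (q - r) ^ 2 * g r) * ∫⁻ r, g r := lintegral_mono h1
    _ = (∫⁻ q, ∫⁻ r, f (q - r) ^ 2 * g r) * ∫⁻ r, g r :=
        lintegral_mul_const _ hm.lintegral_prod_right'
    _ = (∫⁻ r, ∫⁻ q, f (q - r) ^ 2 * g r) * ∫⁻ r, g r := by
        rw [lintegral_lintegral_swap hm.aemeasurable]
    _ = (∫⁻ r, (∫⁻ q, f q ^ 2) * g r) * ∫⁻ r, g r := by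
        congr 1
        refine lintegral_congr fun r => ?_
        rw [lintegral_mul_const _ (by fun_prop)]
        congr 1
        exact lintegral_sub_right_eq_self (fun q => f q ^ 2) r
    _ = _ := by
        rw [lintegral_const_mul _ hg]; ring

lemma aux_main (f g h w : ℝ × ℝ → ℝ≥0∞) (hf : Measurable f) (hg : Measurable g)
    (hw : Measurable w) (hw0 : ∀ q, w q ≠ 0) (hwt : ∀ q, w q ≠ ∞) (C : ℝ≥0∞)
    (hC : ∀ q r, w q ≤ C * (w (q - r) + w r))
    (hh : ∀ q, h q ≤ ∫⁻ r, f (q - r) * g r) :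
    ∫⁻ q, (w q * h q) ^ 2 ≤ 4 * C ^ 2 * (∫⁻ q, ((w q)⁻¹) ^ 2) *
      (∫⁻ q, (w q * f q) ^ 2) * ∫⁻ q, (w q * g q) ^ 2 := by
  have hL1 : ∀ f : ℝ × ℝ → ℝ≥0∞, Measurable f →
      (∫⁻ r, f r) ^ 2 ≤ (∫⁻ q, ((w q)⁻¹) ^ 2) * ∫⁻ q, (w q * f q) ^ 2 := by
    intro f hf
    have := aux_cs volume (fun q => (w q)⁻¹) (fun q => w q * f q) (by fun_prop) (by fun_prop)
    refine le_trans (le_of_eq ?_) this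
    congr 1
    refine lintegral_congr fun q => ?_
    rw [← mul_assoc, ENNReal.inv_mul_cancel (hw0 q) (hwt q), one_mul]
  have hsq : ∀ a b : ℝ≥0∞, (a + b) ^ 2 ≤ 2 * (a ^ 2 + b ^ 2) := by
    intro a b
    have := ENNReal.rpow_add_le_mul_rpow_add_rpow a b (p := 2) (by norm_num)
    norm_num at this
    exact this
  have key : ∀ q, (w q * h q) ^ 2 ≤ 2 * C ^ 2 * ((∫⁻ r, (w (q - r) * f (q - r)) * g r) ^ 2 +
      (∫⁻ r, (w (q - r) * g (q - r)) * f r) ^ 2) := by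
    intro q
    have e1 : ∫⁻ r, (w (q - r) * g (q - r)) * f r = ∫⁻ r, (w r * g r) * f (q - r) := by
      rw [← lintegral_sub_left_eq_self _ q]
      simp
    have : w q * h q ≤ C * ((∫⁻ r, (w (q - r) * f (q - r)) * g r) +
      (∫⁻ r, (w (q - r) * g (q - r)) * f r)) := by
      rw [e1, ← lintegral_add_left (by fun_prop), ← lintegral_const_mul _ (by fun_prop)]
      refine (mul_le_mul_right (hh q) (w q)).trans ?_
      rw [← lintegral_const_mul _ (by fun_prop)]
      refine lintegral_mono fun r => ?_
      calc w q * (f (q - r) * g r) ≤ C * (w (q - r) + w r) * (f (q - r) * g r) := by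
            gcongr; exact hC q r
        _ = _ := by ring
    calc _ ≤ (C * ((∫⁻ r, (w (q - r) * f (q - r)) * g r) +
      (∫⁻ r, (w (q - r) * g (q - r)) * f r))) ^ 2 := by gcongr
      _ ≤ _ := by
        rw [mul_pow, mul_comm 2, mul_assoc]
        gcongr
        exact hsq _ _
  have hm : ∀ f g : ℝ × ℝ → ℝ≥0∞, Measurable f → Measurable g →
      Measurable fun q => (∫⁻ r, (w (q - r) * f (q - r)) * g r) ^ 2 := by
    intro f g hf hg
    have hm : Measurable (Function.uncurry
        fun (q r : ℝ × ℝ) => (w (q - r) * f (q - r)) * g r) := by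
      unfold Function.uncurry; fun_prop
    exact hm.lintegral_prod_right'.pow_const 2
  calc _ ≤ _ := lintegral_mono key
    _ = 2 * C ^ 2 * ((∫⁻ q, (∫⁻ r, (w (q - r) * f (q - r)) * g r) ^ 2) +
      ∫⁻ q, (∫⁻ r, (w (q - r) * g (q - r)) * f r) ^ 2) := by
        rw [lintegral_const_mul, lintegral_add_left (hm f g hf hg)]
        exact (hm f g hf hg).add (hm g f hg hf)
    _ ≤ 2 * C ^ 2 * ((∫⁻ q, (w q * f q) ^ 2) * ((∫⁻ q, ((w q)⁻¹) ^ 2) * ∫⁻ q, (w q * g q) ^ 2) +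
        (∫⁻ q, (w q * g q) ^ 2) * ((∫⁻ q, ((w q)⁻¹) ^ 2) * ∫⁻ q, (w q * f q) ^ 2)) := by
        gcongr
        · exact (aux_young (fun q => w q * f q) g (by fun_prop) hg).trans
            (mul_le_mul_right (hL1 g hg) _)
        · exact (aux_young (fun q => w q * g q) f (by fun_prop) hf).trans
            (mul_le_mul_right (hL1 f hf) _)
    _ = _ := by ring

open scoped FourierTransform in
lemma aux_fourier (u : SchwartzMap (ℝ × ℝ) ℂ) :
    ∃ U : SchwartzMap (ℝ × ℝ) ℂ, (∀ q, U q = FT2 u q) ∧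
      ∀ p, u p = ((((2 * Real.pi) ^ 2)⁻¹ : ℝ) : ℂ) * ∫ r : ℝ × ℝ,
        Complex.exp (Complex.I * ((p.1 : ℂ) * (r.1 : ℂ) + (p.2 : ℂ) * (r.2 : ℂ))) * U r := by
  have hpi : (2 * Real.pi) ≠ 0 := by positivity
  let e := WithLp.prodContinuousLinearEquiv 2 ℝ ℝ ℝ
  let w : SchwartzMap (WithLp 2 (ℝ × ℝ)) ℂ := SchwartzMap.compCLMOfContinuousLinearEquiv ℂ e u
  let g : (ℝ × ℝ) ≃L[ℝ] WithLp 2 (ℝ × ℝ) :=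
    (ContinuousLinearEquiv.unitsEquiv ℝ (ℝ × ℝ)
      (Units.mk ((2 * Real.pi)⁻¹ • ContinuousLinearMap.id ℝ (ℝ × ℝ))
        ((2 * Real.pi) • ContinuousLinearMap.id ℝ (ℝ × ℝ))
        (by ext <;> simp <;> field_simp) (by ext <;> simp <;> field_simp))).trans e.symm
  let U := SchwartzMap.compCLMOfContinuousLinearEquiv ℂ g (𝓕 w)
  have hg : ∀ q, g q = WithLp.toLp 2 ((2 * Real.pi)⁻¹ • q) := fun q => rfl
  have hU : ∀ q, U q = 𝓕 (w : WithLp 2 (ℝ × ℝ) → ℂ) (WithLp.toLp 2 ((2 * Real.pi)⁻¹ • q)) :=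
    fun q => rfl
  have hI : ∀ F : WithLp 2 (ℝ × ℝ) → ℂ, ∫ x, F x = ∫ p : ℝ × ℝ, F (WithLp.toLp 2 p) := by
    intro F
    exact ((WithLp.volume_preserving_toLp ℝ ℝ).integral_comp
      (MeasurableEquiv.toLp 2 (ℝ × ℝ)).measurableEmbedding F).symm
  refine ⟨U, fun q => ?_, fun p => ?_⟩
  · rw [hU, Real.fourier_eq', hI, FT2]
    refine integral_congr_ae (Filter.Eventually.of_forall fun p => ?_)
    simp only [WithLp.prod_inner_apply, smul_eq_mul]
    have : w (WithLp.toLp 2 p) = u p := rfl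
    rw [this]
    congr 2
    simp
    field_simp
  · have h1 : u p = w (WithLp.toLp 2 p) := rfl
    have h2 : w (WithLp.toLp 2 p) = 𝓕⁻ (𝓕 w) (WithLp.toLp 2 p) := by
      rw [FourierTransform.fourierInv_fourier_eq]
    rw [h1, h2, SchwartzMap.fourierInv_coe, Real.fourierInv_eq', hI]
    have h3 := Measure.integral_comp_smul (volume : Measure (ℝ × ℝ)) (fun r : ℝ × ℝ =>
      Complex.exp (Complex.I * ((p.1 : ℂ) * (r.1 : ℂ) + (p.2 : ℂ) * (r.2 : ℂ))) * U r) (2 * Real.pi)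
    have hfr : Module.finrank ℝ (ℝ × ℝ) = 2 := by simp
    rw [hfr, abs_of_pos (by positivity)] at h3
    rw [← Complex.real_smul, ← h3]
    refine integral_congr_ae (Filter.Eventually.of_forall fun r => ?_)
    have : U ((2 * Real.pi) • r) = 𝓕 w (WithLp.toLp 2 r) := by
      rw [hU, smul_smul, inv_mul_cancel₀ hpi, one_smul]; rfl
    simp only [WithLp.prod_inner_apply, smul_eq_mul]
    rw [this]
    congr 2
    simp
    ring

lemma aux_conv (u v : SchwartzMap (ℝ × ℝ) ℂ) (U V : SchwartzMap (ℝ × ℝ) ℂ) (κ : ℂ)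
    (hU : ∀ q, U q = FT2 u q)
    (hV : ∀ p, v p = κ * ∫ r : ℝ × ℝ,
        Complex.exp (Complex.I * ((p.1 : ℂ) * (r.1 : ℂ) + (p.2 : ℂ) * (r.2 : ℂ))) * V r) (q : ℝ × ℝ) :
    FT2 (fun p => u p * v p) q = κ * ∫ r, U (q - r) * V r := by
  have e1 : ∀ r, U (q - r) * V r = ∫ p : ℝ × ℝ, (Complex.exp (-(Complex.I *
      ((p.1 : ℂ) * ((q - r).1 : ℂ) + (p.2 : ℂ) * ((q - r).2 : ℂ)))) * u p) * V r := by
    intro r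
    rw [integral_mul_const, hU, FT2]
  simp_rw [e1]
  rw [integral_integral_swap, FT2, ← integral_const_mul]
  · refine integral_congr_ae (Filter.Eventually.of_forall fun p => ?_)
    simp only [hV p]
    rw [mul_left_comm _ κ, mul_left_comm _ κ, ← integral_const_mul, ← integral_const_mul]
    congr 1
    refine integral_congr_ae (Filter.Eventually.of_forall fun r => ?_)
    have : Complex.exp (-(Complex.I *
      ((p.1 : ℂ) * ((q - r).1 : ℂ) + (p.2 : ℂ) * ((q - r).2 : ℂ)))) =
      Complex.exp (-(Complex.I * ((p.1 : ℂ) * (q.1 : ℂ) + (p.2 : ℂ) * (q.2 : ℂ)))) *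
      Complex.exp (Complex.I * ((p.1 : ℂ) * (r.1 : ℂ) + (p.2 : ℂ) * (r.2 : ℂ))) := by
      rw [← Complex.exp_add]; congr 1
      simp; ring
    simp only [this]
    ring
  · have hb : Integrable (fun z : (ℝ × ℝ) × (ℝ × ℝ) => V z.1 * u z.2)
        (volume.prod volume) := V.integrable.mul_prod u.integrable
    refine hb.mono ?_ (Filter.Eventually.of_forall fun z => ?_)
    · have := u.continuous
      have := V.continuous
      apply Continuous.aestronglyMeasurable
      unfold Function.uncurry
      fun_prop
    · simp only [Function.uncurry, norm_mul]
      rw [Complex.norm_exp]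
      simp
      rw [mul_comm]

noncomputable def auxW (s₁ s₂ : ℝ) (q : ℝ × ℝ) : ℝ :=
  1 + (1 + q.1 ^ 2) ^ s₁ + (1 + q.2 ^ 2) ^ s₂

lemma auxW_pos (s₁ s₂ : ℝ) (q : ℝ × ℝ) : 0 < auxW s₁ s₂ q := by
  unfold auxW; positivity

lemma auxW_cont (s₁ s₂ : ℝ) : Continuous (auxW s₁ s₂) := by
  unfold auxW
  have h : ∀ (s : ℝ), Continuous fun x : ℝ => (1 + x ^ 2) ^ s := fun s =>
    Continuous.rpow_const (by fun_prop) (fun x => Or.inl (by positivity))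
  exact (continuous_const.add ((h s₁).comp continuous_fst)).add ((h s₂).comp continuous_snd)

lemma aux_pw (s : ℝ) (hs : 1 < s) (a b : ℝ) :
    (1 + a ^ 2) ^ s ≤ 4 ^ s * ((1 + (a - b) ^ 2) ^ s + (1 + b ^ 2) ^ s) := by
  have h0 : 0 ≤ s := by linarith
  rcases le_total ((a - b) ^ 2) (b ^ 2) with h | h
  · calc (1 + a ^ 2) ^ s ≤ (4 * (1 + b ^ 2)) ^ s := by
          gcongr
          nlinarith [sq_nonneg (a - 2 * b)]
      _ = 4 ^ s * (1 + b ^ 2) ^ s := Real.mul_rpow (by norm_num) (by positivity)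
      _ ≤ _ := by
        gcongr
        have : (0:ℝ) ≤ (1 + (a - b) ^ 2) ^ s := by positivity
        linarith
  · calc (1 + a ^ 2) ^ s ≤ (4 * (1 + (a - b) ^ 2)) ^ s := by
          gcongr
          nlinarith [sq_nonneg (a - 2 * b)]
      _ = 4 ^ s * (1 + (a - b) ^ 2) ^ s := Real.mul_rpow (by norm_num) (by positivity)
      _ ≤ _ := by
        gcongr
        have : (0:ℝ) ≤ (1 + b ^ 2) ^ s := by positivity
        linarith

lemma auxW_sub (s₁ s₂ : ℝ) (hs₁ : 1 < s₁) (hs₂ : 1 < s₂) (q r : ℝ × ℝ) :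
    auxW s₁ s₂ q ≤ (1 + 4 ^ s₁ + 4 ^ s₂) * (auxW s₁ s₂ (q - r) + auxW s₁ s₂ r) := by
  have h1 := aux_pw s₁ hs₁ q.1 r.1
  have h2 := aux_pw s₂ hs₂ q.2 r.2
  simp only [auxW, Prod.fst_sub, Prod.snd_sub]
  have p1 : (0:ℝ) < 4 ^ s₁ := by positivity
  have p2 : (0:ℝ) < 4 ^ s₂ := by positivity
  have a1 : 0 ≤ (1 + (q.1 - r.1) ^ 2) ^ s₁ := by positivity
  have a2 : 0 ≤ (1 + (q.2 - r.2) ^ 2) ^ s₂ := by positivity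
  have a3 : 0 ≤ (1 + r.1 ^ 2) ^ s₁ := by positivity
  have a4 : 0 ≤ (1 + r.2 ^ 2) ^ s₂ := by positivity
  generalize (1 + (q.1 - r.1) ^ 2) ^ s₁ = x1 at *
  generalize (1 + (q.2 - r.2) ^ 2) ^ s₂ = x2 at *
  generalize (1 + r.1 ^ 2) ^ s₁ = x3 at *
  generalize (1 + r.2 ^ 2) ^ s₂ = x4 at *
  nlinarith [mul_nonneg p1.le a1, mul_nonneg p1.le a2, mul_nonneg p1.le a3, mul_nonneg p1.le a4,
    mul_nonneg p2.le a1, mul_nonneg p2.le a2, mul_nonneg p2.le a3, mul_nonneg p2.le a4]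

lemma auxW_int (s₁ s₂ : ℝ) (hs₁ : 1 < s₁) (hs₂ : 1 < s₂) :
    Integrable (fun q => (auxW s₁ s₂ q)⁻¹) := by
  have h : ∀ s : ℝ, 1 < s → Integrable (fun x : ℝ => ((1 : ℝ) + x ^ 2) ^ (-s / 2)) := by
    intro s hs
    have := integrable_rpow_neg_one_add_norm_sq (E := ℝ) (μ := volume) (r := s) (by simpa using hs)
    simpa using this
  have hp := (h s₁ hs₁).mul_prod (h s₂ hs₂)
  refine hp.mono' ?_ (Filter.Eventually.of_forall fun q => ?_)
  · exact ((auxW_cont s₁ s₂).inv₀ (fun q => (auxW_pos s₁ s₂ q).ne')).aestronglyMeasurable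
  · rw [Real.norm_of_nonneg (inv_nonneg.2 (auxW_pos _ _ _).le), neg_div, neg_div,
      Real.rpow_neg (by positivity), Real.rpow_neg (by positivity), ← mul_inv]
    apply inv_anti₀ (by positivity)
    have e : ∀ (s x : ℝ), (1 + x ^ 2) ^ s = ((1 + x ^ 2) ^ (s / 2)) ^ 2 := by
      intro s x
      rw [← Real.rpow_mul_natCast (by positivity)]
      norm_num
    rw [auxW, e s₁, e s₂]
    nlinarith [sq_nonneg ((1 + q.1 ^ 2) ^ (s₁ / 2) - (1 + q.2 ^ 2) ^ (s₂ / 2)),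
      sq_nonneg ((1 + q.1 ^ 2) ^ (s₁ / 2)), sq_nonneg ((1 + q.2 ^ 2) ^ (s₂ / 2))]

lemma aux_wint (s : ℝ) (φ : ℝ × ℝ → ℝ) (hφ : Continuous φ) (hb : ∀ q, |φ q| ≤ ‖q‖)
    (U : SchwartzMap (ℝ × ℝ) ℂ) (hs : 0 ≤ s) :
    Integrable (fun q => (1 + φ q ^ 2) ^ s * ‖U q‖ ^ 2) := by
  obtain ⟨n, hn⟩ := exists_nat_ge (2 * s)
  obtain ⟨B, hB⟩ : ∃ B : ℝ, ∀ q, (1 + ‖q‖) ^ n * ‖U q‖ ≤ B :=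
    ⟨_, fun q => by
      simpa using SchwartzMap.one_add_le_sup_seminorm_apply (𝕜 := ℂ) (m := (n, 0)) (k := n) (n := 0)
        le_rfl le_rfl U q⟩
  refine (U.integrable.norm.const_mul B).mono' ?_ (Filter.Eventually.of_forall fun q => ?_)
  · have := U.continuous
    have h2 : Continuous fun q => (1 + φ q ^ 2) ^ s :=
      Continuous.rpow_const (by fun_prop) (fun x => Or.inl (by positivity))
    exact (h2.mul (by fun_prop)).aestronglyMeasurable
  · rw [Real.norm_of_nonneg (by positivity), pow_two ‖U q‖, ← mul_assoc]
    refine mul_le_mul_of_nonneg_right (le_trans ?_ (hB q)) (norm_nonneg _)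
    gcongr
    have h1 : 1 + φ q ^ 2 ≤ (1 + ‖q‖) ^ 2 := by
      have := hb q
      nlinarith [sq_abs (φ q), abs_nonneg (φ q), norm_nonneg q]
    calc (1 + φ q ^ 2) ^ s ≤ ((1 + ‖q‖) ^ 2) ^ s := by gcongr
      _ = (1 + ‖q‖) ^ (2 * s) := by
        rw [← Real.rpow_natCast, ← Real.rpow_mul (by positivity)]; norm_num
      _ ≤ (1 + ‖q‖) ^ (n : ℝ) :=
        Real.rpow_le_rpow_of_exponent_le (by linarith [norm_nonneg q]) hn
      _ = _ := Real.rpow_natCast _ _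

lemma aux_norm (s₁ s₂ : ℝ) (hs₁ : 1 < s₁) (hs₂ : 1 < s₂) (u : ℝ × ℝ → ℂ)
    (U : SchwartzMap (ℝ × ℝ) ℂ) (hU : ∀ q, U q = FT2 u q) :
    Integrable (fun q => auxW s₁ s₂ q * ‖U q‖ ^ 2) ∧
    anisoNorm s₁ s₂ u = Real.sqrt (∫ q, auxW s₁ s₂ q * ‖U q‖ ^ 2) := by
  have i1 := aux_wint s₁ Prod.fst continuous_fst (fun q => norm_fst_le q) U (by linarith)
  have i2 := aux_wint s₂ Prod.snd continuous_snd (fun q => norm_snd_le q) U (by linarith)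
  have i0 := aux_wint 0 Prod.snd continuous_snd (fun q => norm_snd_le q) U le_rfl
  simp only [Real.rpow_zero, one_mul] at i0
  have e : ∀ (s x : ℝ), (1 + x ^ 2) ^ s = ((1 + x ^ 2) ^ (s / 2)) ^ 2 := by
    intro s x
    rw [← Real.rpow_mul_natCast (by positivity)]
    norm_num
  have e3 : ∀ (s x : ℝ) (z : ℂ), ‖(((1 + x ^ 2) ^ (s / 2) : ℝ) : ℂ) * z‖ ^ 2 =
      (1 + x ^ 2) ^ s * ‖z‖ ^ 2 := by
    intro s x z
    rw [norm_mul, Complex.norm_real, Real.norm_of_nonneg (by positivity), mul_pow, ← e]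
  have e2 : (fun q => auxW s₁ s₂ q * ‖U q‖ ^ 2) = fun q => ‖U q‖ ^ 2 +
      (1 + q.1 ^ 2) ^ s₁ * ‖U q‖ ^ 2 + (1 + q.2 ^ 2) ^ s₂ * ‖U q‖ ^ 2 := by
    funext q; unfold auxW; ring
  rw [e2]
  refine ⟨(i0.add i1).add i2, ?_⟩
  rw [integral_add (by exact i0.add i1) i2, integral_add i0 i1, anisoNorm, Real.sqrt_eq_rpow]
  simp only [e3, ← hU]

lemma aux_enn (s₁ s₂ : ℝ) (U : SchwartzMap (ℝ × ℝ) ℂ)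
    (hi : Integrable (fun q => auxW s₁ s₂ q * ‖U q‖ ^ 2)) :
    ∫⁻ q, (ENNReal.ofReal (Real.sqrt (auxW s₁ s₂ q)) * ‖U q‖ₑ) ^ 2 =
      ENNReal.ofReal (∫ q, auxW s₁ s₂ q * ‖U q‖ ^ 2) := by
  rw [ofReal_integral_eq_lintegral_ofReal hi
    (Filter.Eventually.of_forall fun q => mul_nonneg (auxW_pos _ _ _).le (sq_nonneg _))]
  refine lintegral_congr fun q => ?_
  rw [← ofReal_norm, ← ENNReal.ofReal_mul (Real.sqrt_nonneg _),
    ← ENNReal.ofReal_pow (by positivity), mul_pow, Real.sq_sqrt (auxW_pos _ _ _).le]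

/-- `H^{s₁,s₂}(ℝ²)` is a Banach algebra for `s₁, s₂ > 1`:
there is `c > 0` with `N(uv) ≤ c N(u) N(v)` for all Schwartz `u, v`. -/
theorem anisotropic_sobolev_algebra (s₁ s₂ : ℝ) (hs₁ : 1 < s₁) (hs₂ : 1 < s₂) :
    ∃ c : ℝ, 0 < c ∧ ∀ u v : SchwartzMap (ℝ × ℝ) ℂ,
      anisoNorm s₁ s₂ (fun p => u p * v p)
        ≤ c * anisoNorm s₁ s₂ (⇑u) * anisoNorm s₁ s₂ (⇑v) := by
  set w : ℝ × ℝ → ℝ≥0∞ := fun q => ENNReal.ofReal (Real.sqrt (auxW s₁ s₂ q)) with hw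
  set D : ℝ := 1 + 4 ^ s₁ + 4 ^ s₂ with hD
  have hD0 : 0 ≤ D := by positivity
  set C : ℝ≥0∞ := ENNReal.ofReal (Real.sqrt D) with hC
  have hwC : ∀ q r, w q ≤ C * (w (q - r) + w r) := by
    intro q r
    simp only [hw, hC]
    rw [← ENNReal.ofReal_add (Real.sqrt_nonneg _) (Real.sqrt_nonneg _),
      ← ENNReal.ofReal_mul (Real.sqrt_nonneg _)]
    apply ENNReal.ofReal_le_ofReal
    calc Real.sqrt (auxW s₁ s₂ q)
        ≤ Real.sqrt (D * (auxW s₁ s₂ (q - r) + auxW s₁ s₂ r)) :=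
          Real.sqrt_le_sqrt (auxW_sub s₁ s₂ hs₁ hs₂ q r)
      _ = Real.sqrt D * Real.sqrt (auxW s₁ s₂ (q - r) + auxW s₁ s₂ r) := Real.sqrt_mul hD0 _
      _ ≤ _ := by
        gcongr
        apply Real.sqrt_le_iff.2 ⟨by positivity, ?_⟩
        have := Real.sq_sqrt (auxW_pos s₁ s₂ (q - r)).le
        have := Real.sq_sqrt (auxW_pos s₁ s₂ r).le
        have := mul_nonneg (Real.sqrt_nonneg (auxW s₁ s₂ (q - r))) (Real.sqrt_nonneg (auxW s₁ s₂ r))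
        nlinarith
  have hwm : Measurable w :=
    ENNReal.measurable_ofReal.comp ((Real.continuous_sqrt.comp (auxW_cont s₁ s₂)).measurable)
  have hw0 : ∀ q, w q ≠ 0 := fun q => by
    simp only [hw]
    exact (ENNReal.ofReal_pos.2 (Real.sqrt_pos.2 (auxW_pos _ _ _))).ne'
  have hwt : ∀ q, w q ≠ ∞ := fun q => ENNReal.ofReal_ne_top
  have hK : ∫⁻ q, ((w q)⁻¹) ^ 2 ≠ ∞ := by
    have : ∫⁻ q, ((w q)⁻¹) ^ 2 = ∫⁻ q, ENNReal.ofReal ((auxW s₁ s₂ q)⁻¹) := by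
      refine lintegral_congr fun q => ?_
      simp only [hw]
      rw [← ENNReal.ofReal_inv_of_pos (Real.sqrt_pos.2 (auxW_pos _ _ _)),
        ← ENNReal.ofReal_pow (by positivity), inv_pow, Real.sq_sqrt (auxW_pos _ _ _).le]
    rw [this]
    exact (auxW_int s₁ s₂ hs₁ hs₂).lintegral_lt_top.ne
  set M : ℝ≥0∞ := 4 * C ^ 2 * (∫⁻ q, ((w q)⁻¹) ^ 2) with hM
  have hMt : M ≠ ∞ := by
    refine ENNReal.mul_ne_top (ENNReal.mul_ne_top (by norm_num) ?_) hK
    exact ENNReal.pow_ne_top ENNReal.ofReal_ne_top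
  refine ⟨Real.sqrt M.toReal + 1, by positivity, fun u v => ?_⟩
  obtain ⟨U, hU, -⟩ := aux_fourier u
  obtain ⟨V, hV, hV'⟩ := aux_fourier v
  obtain ⟨P, hP, -⟩ := aux_fourier (SchwartzMap.pairing (ContinuousLinearMap.mul ℂ ℂ) u v)
  have hP' : ∀ q, P q = FT2 (fun p => u p * v p) q := hP
  obtain ⟨iU, nU⟩ := aux_norm s₁ s₂ hs₁ hs₂ u U hU
  obtain ⟨iV, nV⟩ := aux_norm s₁ s₂ hs₁ hs₂ v V hV
  obtain ⟨iP, nP⟩ := aux_norm s₁ s₂ hs₁ hs₂ (fun p => u p * v p) P hP'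
  have hh : ∀ q, ‖P q‖ₑ ≤ ∫⁻ r, ‖U (q - r)‖ₑ * ‖V r‖ₑ := by
    intro q
    rw [hP', aux_conv u v U V _ hU hV' q, enorm_mul]
    have hk : ‖((((2 * Real.pi) ^ 2)⁻¹ : ℝ) : ℂ)‖ₑ ≤ 1 := by
      rw [← ofReal_norm, Complex.norm_real, Real.norm_of_nonneg (by positivity)]
      rw [ENNReal.ofReal_le_one]
      apply inv_le_one_of_one_le₀
      nlinarith [Real.pi_gt_three]
    refine (mul_le_mul' hk (enorm_integral_le_lintegral_enorm _)).trans ?_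
    rw [one_mul]
    simp only [enorm_mul]
    exact le_rfl
  have main := aux_main (fun q => ‖U q‖ₑ) (fun q => ‖V q‖ₑ) (fun q => ‖P q‖ₑ) w
    U.continuous.measurable.enorm V.continuous.measurable.enorm hwm hw0 hwt C hwC hh
  rw [← hM] at main
  simp only [hw] at main
  rw [aux_enn _ _ _ iU, aux_enn _ _ _ iV, aux_enn _ _ _ iP] at main
  rw [nU, nV, nP]
  have pos : ∀ U : SchwartzMap (ℝ × ℝ) ℂ, 0 ≤ ∫ q, auxW s₁ s₂ q * ‖U q‖ ^ 2 := fun U =>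
    integral_nonneg fun q => mul_nonneg (auxW_pos _ _ _).le (sq_nonneg _)
  rw [← ENNReal.ofReal_toReal hMt, ← ENNReal.ofReal_mul ENNReal.toReal_nonneg,
    ← ENNReal.ofReal_mul (mul_nonneg ENNReal.toReal_nonneg (pos U)),
    ENNReal.ofReal_le_ofReal_iff
      (mul_nonneg (mul_nonneg ENNReal.toReal_nonneg (pos U)) (pos V))] at main
  calc _ ≤ _ := Real.sqrt_le_sqrt main
    _ = Real.sqrt M.toReal * Real.sqrt (∫ q, auxW s₁ s₂ q * ‖U q‖ ^ 2) *
        Real.sqrt (∫ q, auxW s₁ s₂ q * ‖V q‖ ^ 2) := by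
      rw [Real.sqrt_mul (mul_nonneg ENNReal.toReal_nonneg (pos U)),
        Real.sqrt_mul ENNReal.toReal_nonneg]
    _ ≤ _ := by
      gcongr
      linarith
end
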